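/- arXiv:2508.02030 — 4 statements merged into one kernel-verified Lean document; each statement's English description precedes it below -/
import Mathlib

section
/- Let p n denote the number of full permutations of Fin n. Then p 1 = 1, and for every n ≥ 0, p (n+2) = p (n+1) + ∑_{j=0}^{n} p (j+1) · p (n+1−j). That is, the shifted sequence c n = p (n+1) satisfies the defining recurrence of the large Schröder numbers: c 0 = 1 and c (n+1) = c n + ∑_{j=0}^{n} c j · c (n−j). -/
/-- Two cells of the `n × n` board are cardinal (north/south/east/west) neighbors. -/
def Adj {n : ℕ} (c d : Fin n × Fin n) : Prop :=
  (c.1 = d.1 ∧ ((c.2 : ℕ) + 1 = (d.2 : ℕ) ∨ (d.2 : ℕ) + 1 = (c.2 : ℕ))) ∨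
  (c.2 = d.2 ∧ ((c.1 : ℕ) + 1 = (d.1 : ℕ) ∨ (d.1 : ℕ) + 1 = (c.1 : ℕ)))

/-- A cell `c` is mutable for a set `T` of cells: `c ∉ T` and at least two of its
cardinal neighbors belong to `T`. -/
def IsMutable {n : ℕ} (T : Set (Fin n × Fin n)) (c : Fin n × Fin n) : Prop :=
  c ∉ T ∧ ∃ d ∈ T, ∃ e ∈ T, d ≠ e ∧ Adj c d ∧ Adj c e

/-- One percolation step: adjoin a single mutable cell. -/
def PercStep {n : ℕ} (T T' : Set (Fin n × Fin n)) : Prop :=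
  ∃ c, IsMutable T c ∧ T' = T ∪ {c}

/-- The graph of a permutation `π`, i.e. the set of cells `(i, π i)`. -/
def graphOf {n : ℕ} (π : Equiv.Perm (Fin n)) : Set (Fin n × Fin n) :=
  {p | p.2 = π p.1}

/-- A set of cells is percolation-closed if it contains every cell having at least two
cardinal neighbors in the set. -/
def PercClosed {n : ℕ} (S : Set (Fin n × Fin n)) : Prop :=
  ∀ c, (∃ d ∈ S, ∃ e ∈ S, d ≠ e ∧ Adj c d ∧ Adj c e) → c ∈ S

/-- The percolation closure of `π`: the smallest percolation-closed set containing the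
graph of `π`. -/
def percClosure {n : ℕ} (π : Equiv.Perm (Fin n)) : Set (Fin n × Fin n) :=
  ⋂₀ {S | graphOf π ⊆ S ∧ PercClosed S}

/-- `π` is full if its percolation closure is the whole board. -/
def Full {n : ℕ} (π : Equiv.Perm (Fin n)) : Prop :=
  percClosure π = Set.univ

/-- A permutation of `Fin m` is indecomposable if it maps no proper initial segment
`{0, …, k−1}` (with `1 ≤ k < m`) onto itself. -/
def Indecomposable {m : ℕ} (σ : Equiv.Perm (Fin m)) : Prop :=
  ¬ ∃ k, 1 ≤ k ∧ k < m ∧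
    (fun i => σ i) '' {i : Fin m | (i : ℕ) < k} = {i : Fin m | (i : ℕ) < k}

/-- `π` is no-growth if no cell is mutable for its graph. -/
def NoGrowth {n : ℕ} (π : Equiv.Perm (Fin n)) : Prop :=
  ∀ c, ¬ IsMutable (graphOf π) c

/-- The number of full permutations of `Fin m`. -/
noncomputable def numFull (m : ℕ) : ℕ :=
  Nat.card {π : Equiv.Perm (Fin m) // Full π}

/-- The number of full indecomposable permutations of `Fin m`. -/
noncomputable def numFullIndec (m : ℕ) : ℕ :=
  Nat.card {π : Equiv.Perm (Fin m) // Full π ∧ Indecomposable π}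

inductive PSep (f : ℕ → ℕ) : ℕ → ℕ → Prop
  | one (a : ℕ) : PSep f a (a + 1)
  | inc (a m b : ℕ) : a < m → m < b → PSep f a m → PSep f m b →
      (∀ i j, a ≤ i → i < m → m ≤ j → j < b → f i < f j) → PSep f a b
  | dec (a m b : ℕ) : a < m → m < b → PSep f a m → PSep f m b →
      (∀ i j, a ≤ i → i < m → m ≤ j → j < b → f j < f i) → PSep f a b

theorem PSep.sub {f : ℕ → ℕ} {a b : ℕ} (h : PSep f a b) :
    ∀ a' b', a ≤ a' → a' < b' → b' ≤ b → PSep f a' b' := by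
  induction h with
  | one a =>
    intro a' b' h1 h2 h3
    obtain rfl : a' = a := by omega
    obtain rfl : b' = a' + 1 := by omega
    exact PSep.one _
  | inc a m b h1 h2 _ _ h3 ih1 ih2 =>
    intro a' b' g1 g2 g3
    by_cases c1 : b' ≤ m
    · exact ih1 _ _ g1 g2 c1
    by_cases c2 : m ≤ a'
    · exact ih2 _ _ c2 g2 g3
    exact PSep.inc a' m b' (by omega) (by omega) (ih1 _ _ g1 (by omega) le_rfl)
      (ih2 _ _ le_rfl (by omega) g3)
      (fun i j k1 k2 k3 k4 => h3 i j (by omega) k2 k3 (by omega))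
  | dec a m b h1 h2 _ _ h3 ih1 ih2 =>
    intro a' b' g1 g2 g3
    by_cases c1 : b' ≤ m
    · exact ih1 _ _ g1 g2 c1
    by_cases c2 : m ≤ a'
    · exact ih2 _ _ c2 g2 g3
    exact PSep.dec a' m b' (by omega) (by omega) (ih1 _ _ g1 (by omega) le_rfl)
      (ih2 _ _ le_rfl (by omega) g3)
      (fun i j k1 k2 k3 k4 => h3 i j (by omega) k2 k3 (by omega))

/-- order preserving transport with upward shift -/
theorem PSep.up {f g : ℕ → ℕ} {a b : ℕ} (h : PSep f a b) (s : ℕ)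
    (hg : ∀ i j, a ≤ i → i < b → a ≤ j → j < b → f i < f j → g (i + s) < g (j + s)) :
    PSep g (a + s) (b + s) := by
  induction h with
  | one a => rw [show a + 1 + s = a + s + 1 by omega]; exact PSep.one _
  | inc a m b h1 h2 _ _ h3 ih1 ih2 =>
    refine PSep.inc _ (m + s) _ (by omega) (by omega)
      (ih1 fun i j k1 k2 k3 k4 => hg i j k1 (by omega) k3 (by omega))
      (ih2 fun i j k1 k2 k3 k4 => hg i j (by omega) (by omega) (by omega) (by omega)) ?_
    intro i j k1 k2 k3 k4
    have := hg (i - s) (j - s) (by omega) (by omega) (by omega) (by omega)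
      (h3 _ _ (by omega) (by omega) (by omega) (by omega))
    rwa [Nat.sub_add_cancel (by omega), Nat.sub_add_cancel (by omega)] at this
  | dec a m b h1 h2 _ _ h3 ih1 ih2 =>
    refine PSep.dec _ (m + s) _ (by omega) (by omega)
      (ih1 fun i j k1 k2 k3 k4 => hg i j k1 (by omega) k3 (by omega))
      (ih2 fun i j k1 k2 k3 k4 => hg i j (by omega) (by omega) (by omega) (by omega)) ?_
    intro i j k1 k2 k3 k4
    have := hg (j - s) (i - s) (by omega) (by omega) (by omega) (by omega)
      (h3 _ _ (by omega) (by omega) (by omega) (by omega))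
    rwa [Nat.sub_add_cancel (by omega), Nat.sub_add_cancel (by omega)] at this

theorem PSep.down {f g : ℕ → ℕ} {a b : ℕ} (h : PSep f a b) (s : ℕ) (hs : s ≤ a)
    (hg : ∀ i j, a ≤ i → i < b → a ≤ j → j < b → f i < f j → g (i - s) < g (j - s)) :
    PSep g (a - s) (b - s) := by
  induction h with
  | one a => rw [show a + 1 - s = a - s + 1 by omega]; exact PSep.one _
  | inc a m b h1 h2 _ _ h3 ih1 ih2 =>
    refine PSep.inc _ (m - s) _ (by omega) (by omega)
      (ih1 (by omega) fun i j k1 k2 k3 k4 => hg i j k1 (by omega) k3 (by omega))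
      (ih2 (by omega) fun i j k1 k2 k3 k4 => hg i j (by omega) (by omega) (by omega) (by omega)) ?_
    intro i j k1 k2 k3 k4
    have := hg (i + s) (j + s) (by omega) (by omega) (by omega) (by omega)
      (h3 _ _ (by omega) (by omega) (by omega) (by omega))
    simpa using this
  | dec a m b h1 h2 _ _ h3 ih1 ih2 =>
    refine PSep.dec _ (m - s) _ (by omega) (by omega)
      (ih1 (by omega) fun i j k1 k2 k3 k4 => hg i j k1 (by omega) k3 (by omega))
      (ih2 (by omega) fun i j k1 k2 k3 k4 => hg i j (by omega) (by omega) (by omega) (by omega)) ?_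
    intro i j k1 k2 k3 k4
    have := hg (j + s) (i + s) (by omega) (by omega) (by omega) (by omega)
      (h3 _ _ (by omega) (by omega) (by omega) (by omega))
    simpa using this

theorem PSep.flip {f g : ℕ → ℕ} {a b : ℕ} (h : PSep f a b)
    (hg : ∀ i j, a ≤ i → i < b → a ≤ j → j < b → f i < f j → g j < g i) :
    PSep g a b := by
  induction h with
  | one a => exact PSep.one _
  | inc a m b h1 h2 _ _ h3 ih1 ih2 =>
    refine PSep.dec _ m _ (by omega) (by omega)
      (ih1 fun i j k1 k2 k3 k4 => hg i j k1 (by omega) k3 (by omega))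
      (ih2 fun i j k1 k2 k3 k4 => hg i j (by omega) (by omega) (by omega) (by omega)) ?_
    intro i j k1 k2 k3 k4
    exact hg i j (by omega) (by omega) (by omega) (by omega) (h3 i j k1 k2 k3 k4)
  | dec a m b h1 h2 _ _ h3 ih1 ih2 =>
    refine PSep.inc _ m _ (by omega) (by omega)
      (ih1 fun i j k1 k2 k3 k4 => hg i j k1 (by omega) k3 (by omega))
      (ih2 fun i j k1 k2 k3 k4 => hg i j (by omega) (by omega) (by omega) (by omega)) ?_
    intro i j k1 k2 k3 k4
    exact hg j i (by omega) (by omega) (by omega) (by omega) (h3 i j k1 k2 k3 k4)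

/-- extension of a permutation to naturals -/
def extP {n : ℕ} (π : Equiv.Perm (Fin n)) (i : ℕ) : ℕ :=
  if h : i < n then (π ⟨i, h⟩ : ℕ) else 0

theorem extP_lt {n : ℕ} (π : Equiv.Perm (Fin n)) (i : ℕ) (h : i < n) : extP π i < n := by
  simp [extP, h]

theorem extP_fin {n : ℕ} (π : Equiv.Perm (Fin n)) (i : Fin n) : extP π i = (π i : ℕ) := by
  simp [extP]

theorem extP_inj {n : ℕ} (π : Equiv.Perm (Fin n)) (i j : ℕ) (hi : i < n) (hj : j < n)
    (h : extP π i = extP π j) : i = j := by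
  simp only [extP, hi, hj, dif_pos] at h
  have := π.injective (Fin.ext h)
  simpa using this

theorem extP_surj {n : ℕ} (π : Equiv.Perm (Fin n)) (v : ℕ) (hv : v < n) :
    ∃ i, i < n ∧ extP π i = v := by
  refine ⟨π.symm ⟨v, hv⟩, (π.symm ⟨v, hv⟩).2, ?_⟩
  simp [extP]

/-- a separable block -/
structure Blk (n : ℕ) (f : ℕ → ℕ) (a b c d : ℕ) : Prop where
  sep : PSep f a b
  ab : a < b
  bn : b ≤ n
  cd : c < d
  dn : d ≤ n
  iff : ∀ i, i < n → ((a ≤ i ∧ i < b) ↔ (c ≤ f i ∧ f i < d))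

theorem merge_over {n : ℕ} {f : ℕ → ℕ} {a b c d a' b' c' d' : ℕ}
    (h : Blk n f a b c d) (h' : Blk n f a' b' c' d') (haa : a < a') (hab : a' < b) (hbb : b < b') :
    ∃ A B C D, Blk n f A B C D ∧ A ≤ a ∧ b ≤ B ∧ C ≤ c ∧ d ≤ D ∧
      A ≤ a' ∧ b' ≤ B ∧ C ≤ c' ∧ d' ≤ D := by
  have hbn := h.bn; have hbn' := h'.bn
  have hdn := h.dn; have hdn' := h'.dn
  have hcd := h.cd; have hcd' := h'.cd
  have e1 := h.iff a (by omega)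
  have e2 := h'.iff a (by omega)
  have e3 := h.iff b (by omega)
  have e4 := h'.iff b (by omega)
  have e5 := h.iff a' (by omega)
  have e6 := h'.iff a' (by omega)
  have key : (c < c' ∧ d < d') ∨ (c' < c ∧ d' < d) := by omega
  have sA : PSep f a a' := h.sep.sub _ _ le_rfl haa (by omega)
  rcases key with k | k
  · refine ⟨a, b', c, d', ⟨?_, by omega, hbn', by omega, hdn', ?_⟩, by omega, by omega, by omega,
      by omega, by omega, by omega, by omega, by omega⟩
    · refine PSep.inc a a' b' haa (by omega) sA h'.sep ?_
      intro i j h1 h2 h3 h4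
      have := h.iff i (by omega); have := h'.iff i (by omega); have := h'.iff j (by omega)
      omega
    · intro i hi
      have := h.iff i hi; have := h'.iff i hi
      omega
  · refine ⟨a, b', c', d, ⟨?_, by omega, hbn', by omega, hdn, ?_⟩, by omega, by omega, by omega,
      by omega, by omega, by omega, by omega, by omega⟩
    · refine PSep.dec a a' b' haa (by omega) sA h'.sep ?_
      intro i j h1 h2 h3 h4
      have := h.iff i (by omega); have := h'.iff i (by omega); have := h'.iff j (by omega)
      omega
    · intro i hi
      have := h.iff i hi; have := h'.iff i hi
      omega

theorem merge_adj {n : ℕ} {f : ℕ → ℕ} {a b c d b' c' d' : ℕ}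
    (h : Blk n f a b c d) (h' : Blk n f b b' c' d') (hv : d = c' ∨ d' = c) :
    ∃ A B C D, Blk n f A B C D ∧ A ≤ a ∧ b ≤ B ∧ C ≤ c ∧ d ≤ D ∧
      A ≤ b ∧ b' ≤ B ∧ C ≤ c' ∧ d' ≤ D := by
  have hab := h.ab; have hab' := h'.ab
  have hbn := h.bn; have hbn' := h'.bn
  have hdn := h.dn; have hdn' := h'.dn
  have hcd := h.cd; have hcd' := h'.cd
  rcases hv with rfl | rfl
  · refine ⟨a, b', c, d', ⟨?_, by omega, hbn', by omega, hdn', ?_⟩, by omega, by omega, by omega,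
      by omega, by omega, by omega, by omega, by omega⟩
    · refine PSep.inc a b b' (by omega) (by omega) h.sep h'.sep ?_
      intro i j h1 h2 h3 h4
      have := h.iff i (by omega); have := h'.iff j (by omega)
      omega
    · intro i hi
      have := h.iff i hi; have := h'.iff i hi
      omega
  · refine ⟨a, b', c', d, ⟨?_, by omega, hbn', by omega, hdn, ?_⟩, by omega, by omega, by omega,
      by omega, by omega, by omega, by omega, by omega⟩
    · refine PSep.dec a b b' (by omega) (by omega) h.sep h'.sep ?_
      intro i j h1 h2 h3 h4
      have := h.iff i (by omega); have := h'.iff j (by omega)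
      omega
    · intro i hi
      have := h.iff i hi; have := h'.iff i hi
      omega

theorem merge_nest {n : ℕ} {f : ℕ → ℕ} {a b c d a' b' c' d' : ℕ}
    (hs : ∀ v, v < n → ∃ i, i < n ∧ f i = v)
    (h : Blk n f a b c d) (h' : Blk n f a' b' c' d') (h1 : a ≤ a') (h2 : b' ≤ b) :
    ∃ A B C D, Blk n f A B C D ∧ A ≤ a ∧ b ≤ B ∧ C ≤ c ∧ d ≤ D ∧
      A ≤ a' ∧ b' ≤ B ∧ C ≤ c' ∧ d' ≤ D := by
  have hcd' := h'.cd; have hdn' := h'.dn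
  refine ⟨a, b, c, d, h, le_rfl, le_rfl, le_rfl, le_rfl, h1, h2, ?_, ?_⟩
  · obtain ⟨i, hi, e⟩ := hs c' (by omega)
    have := h.iff i hi; have := h'.iff i hi; omega
  · obtain ⟨i, hi, e⟩ := hs (d' - 1) (by omega)
    have := h.iff i hi; have := h'.iff i hi; omega

theorem merge {n : ℕ} {f : ℕ → ℕ} {a b c d a' b' c' d' : ℕ}
    (hs : ∀ v, v < n → ∃ i, i < n ∧ f i = v)
    (h : Blk n f a b c d) (h' : Blk n f a' b' c' d')
    (x y x' y' : ℕ) (hx : a ≤ x ∧ x < b) (hy : c ≤ y ∧ y < d)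
    (hx' : a' ≤ x' ∧ x' < b') (hy' : c' ≤ y' ∧ y' < d')
    (hd : (x - x') + (x' - x) + ((y - y') + (y' - y)) ≤ 2) :
    ∃ A B C D, Blk n f A B C D ∧ A ≤ a ∧ b ≤ B ∧ C ≤ c ∧ d ≤ D ∧
      A ≤ a' ∧ b' ≤ B ∧ C ≤ c' ∧ d' ≤ D := by
  have hdn := h.dn; have hdn' := h'.dn
  have hab := h.ab; have hab' := h'.ab
  have hcd := h.cd; have hcd' := h'.cd
  by_cases n1 : a ≤ a' ∧ b' ≤ b
  · exact merge_nest hs h h' n1.1 n1.2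
  by_cases n2 : a' ≤ a ∧ b ≤ b'
  · obtain ⟨A, B, C, D, k, k1, k2, k3, k4, k5, k6, k7, k8⟩ := merge_nest hs h' h n2.1 n2.2
    exact ⟨A, B, C, D, k, k5, k6, k7, k8, k1, k2, k3, k4⟩
  by_cases o1 : a < a' ∧ a' < b ∧ b < b'
  · exact merge_over h h' o1.1 o1.2.1 o1.2.2
  by_cases o2 : a' < a ∧ a < b' ∧ b' < b
  · obtain ⟨A, B, C, D, k, k1, k2, k3, k4, k5, k6, k7, k8⟩ := merge_over h' h o2.1 o2.2.1 o2.2.2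
    exact ⟨A, B, C, D, k, k5, k6, k7, k8, k1, k2, k3, k4⟩
  have disj : b ≤ a' ∨ b' ≤ a := by omega
  have vdisj : d ≤ c' ∨ d' ≤ c := by
    by_contra hc
    obtain ⟨i, hi, e⟩ := hs (max c c') (by omega)
    have := h.iff i hi; have := h'.iff i hi; omega
  have hv : d = c' ∨ d' = c := by omega
  have hu : b = a' ∨ b' = a := by omega
  rcases hu with rfl | rfl
  · exact merge_adj h h' hv
  · obtain ⟨A, B, C, D, k, k1, k2, k3, k4, k5, k6, k7, k8⟩ := merge_adj h' h hv.symm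
    exact ⟨A, B, C, D, k, k5, k6, k7, k8, k1, k2, k3, k4⟩

theorem sep_of_full {n : ℕ} (hn : 0 < n) (π : Equiv.Perm (Fin n)) (hf : Full π) :
    PSep (extP π) 0 n := by
  have hs := extP_surj π
  let S : Set (Fin n × Fin n) := {p | ∃ a b c d, Blk n (extP π) a b c d ∧
    (a ≤ (p.1 : ℕ) ∧ (p.1 : ℕ) < b) ∧ (c ≤ (p.2 : ℕ) ∧ (p.2 : ℕ) < d)}
  have hG : graphOf π ⊆ S := by
    rintro ⟨x, y⟩ hxy
    have hy : y = π x := hxy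
    subst hy
    refine ⟨x, x + 1, π x, π x + 1, ⟨PSep.one _, by omega, x.2, by omega, (π x).2, ?_⟩,
      ⟨le_rfl, by simp⟩, ⟨le_rfl, by simp⟩⟩
    intro i hi
    rw [← extP_fin]
    constructor
    · intro h
      obtain rfl : i = x := by omega
      omega
    · intro h
      have := extP_inj π i x hi x.2 (by omega)
      omega
  have hC : PercClosed S := by
    rintro ⟨x, y⟩ ⟨⟨x1, y1⟩, ⟨a, b, c, d, h, hx1, hy1⟩, ⟨x2, y2⟩, ⟨a', b', c', d', h', hx2, hy2⟩,
      hne, ad1, ad2⟩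
    simp only [Adj, Fin.ext_iff, ne_eq, Prod.mk.injEq] at *
    obtain ⟨A, B, C, D, k, k1, k2, k3, k4, k5, k6, k7, k8⟩ :=
      merge hs h h' x1 y1 x2 y2 hx1 hy1 hx2 hy2 (by omega)
    exact ⟨A, B, C, D, k, by dsimp only; omega, by dsimp only; omega⟩
  have hS : ∀ p, p ∈ S := by
    intro p
    have : p ∈ percClosure π := by rw [hf]; trivial
    exact this S ⟨hG, hC⟩
  have grow : ∀ m, m < n → ∃ b c d, Blk n (extP π) 0 b c d ∧ m < b ∧ c = 0 := by
    intro m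
    induction m with
    | zero =>
      intro hm
      obtain ⟨a, b, c, d, h, h1, h2⟩ := hS (⟨0, hm⟩, ⟨0, hm⟩)
      obtain rfl : a = 0 := by simpa using h1.1
      exact ⟨b, c, d, h, h1.2, by simpa using h2.1⟩
    | succ m ih =>
      intro hm
      obtain ⟨b, c, d, h, h1, rfl⟩ := ih (by omega)
      obtain ⟨a', b', c', d', h', h1', h2'⟩ := hS (⟨m + 1, hm⟩, ⟨0, hn⟩)
      dsimp only at h1' h2'
      have hcd := h.cd
      obtain ⟨A, B, C, D, k, k1, k2, k3, k4, k5, k6, k7, k8⟩ :=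
        merge hs h h' m 0 (m + 1) 0 (by omega) (by omega) h1' h2' (by omega)
      obtain rfl : A = 0 := by omega
      exact ⟨B, C, D, k, by omega, by omega⟩
  obtain ⟨b, c, d, h, h1, _⟩ := grow (n - 1) (by omega)
  have := h.bn
  obtain rfl : b = n := by omega
  exact h.sep

theorem quad (Q : ℕ → ℕ → Prop) (w h : ℕ) (h1 : ∀ t, t < h → Q 0 (t + 1))
    (h2 : ∀ s, s < w → Q (s + 1) 0)
    (h3 : ∀ s t, s < w → t < h → Q s (t + 1) → Q (s + 1) t → Q (s + 1) (t + 1)) :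
    ∀ s t, s < w → t < h → Q (s + 1) (t + 1) := by
  intro s
  induction s with
  | zero =>
    intro t
    induction t with
    | zero => intro a b; exact h3 0 0 a b (h1 0 b) (h2 0 a)
    | succ t ih => intro a b; exact h3 0 _ a b (h1 _ b) (ih a (by omega))
  | succ s ihs =>
    intro t
    induction t with
    | zero => intro a b; exact h3 _ 0 a b (ihs 0 (by omega) b) (h2 _ a)
    | succ t ih => intro a b; exact h3 _ _ a b (ihs _ (by omega) b) (ih a (by omega))

def Cl (n : ℕ) (P : ℕ → ℕ → Prop) : Prop :=
  ∀ x y x' y', x < n → y < n → (x' = x + 1 ∨ x = x' + 1) → (y' = y + 1 ∨ y = y' + 1) →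
    P x' y → P x y' → P x y

theorem fill_inc {n : ℕ} {P : ℕ → ℕ → Prop} (hP : Cl n P) {a m b c e d : ℕ}
    (h1 : a < m) (h2 : m < b) (h3 : c < e) (h4 : e < d) (hb : b ≤ n) (hd : d ≤ n)
    (p1 : ∀ x y, a ≤ x → x < m → c ≤ y → y < e → P x y)
    (p2 : ∀ x y, m ≤ x → x < b → e ≤ y → y < d → P x y) :
    ∀ x y, a ≤ x → x < b → c ≤ y → y < d → P x y := by
  have q1 := quad (fun s t => P (m - s) (e + t - 1)) (m - a) (d - e)
    (fun t ht => p2 _ _ (by omega) (by omega) (by omega) (by omega))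
    (fun s hs => p1 _ _ (by omega) (by omega) (by omega) (by omega))
    (fun s t hs ht u v => hP _ _ _ _ (by omega) (by omega) (by omega) (by omega) u v)
  have q2 := quad (fun s t => P (m + s - 1) (e - t)) (b - m) (e - c)
    (fun t ht => p1 _ _ (by omega) (by omega) (by omega) (by omega))
    (fun s hs => p2 _ _ (by omega) (by omega) (by omega) (by omega))
    (fun s t hs ht u v => hP _ _ _ _ (by omega) (by omega) (by omega) (by omega) u v)
  intro x y k1 k2 k3 k4
  by_cases c1 : x < m
  · by_cases c2 : y < e
    · exact p1 x y k1 c1 k3 c2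
    · have := q1 (m - 1 - x) (y - e) (by omega) (by omega)
      try dsimp only at this
      rwa [show m - (m - 1 - x + 1) = x by omega, show e + (y - e + 1) - 1 = y by omega] at this
  · by_cases c2 : y < e
    · have := q2 (x - m) (e - 1 - y) (by omega) (by omega)
      try dsimp only at this
      rwa [show e - (e - 1 - y + 1) = y by omega, show m + (x - m + 1) - 1 = x by omega] at this
    · exact p2 x y (by omega) k2 (by omega) k4

theorem fill_dec {n : ℕ} {P : ℕ → ℕ → Prop} (hP : Cl n P) {a m b c e d : ℕ}
    (h1 : a < m) (h2 : m < b) (h3 : c < e) (h4 : e < d) (hb : b ≤ n) (hd : d ≤ n)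
    (p1 : ∀ x y, a ≤ x → x < m → e ≤ y → y < d → P x y)
    (p2 : ∀ x y, m ≤ x → x < b → c ≤ y → y < e → P x y) :
    ∀ x y, a ≤ x → x < b → c ≤ y → y < d → P x y := by
  have q1 := quad (fun s t => P (m - s) (e - t)) (m - a) (e - c)
    (fun t ht => p2 _ _ (by omega) (by omega) (by omega) (by omega))
    (fun s hs => p1 _ _ (by omega) (by omega) (by omega) (by omega))
    (fun s t hs ht u v => hP _ _ _ _ (by omega) (by omega) (by omega) (by omega) u v)
  have q2 := quad (fun s t => P (m + s - 1) (e + t - 1)) (b - m) (d - e)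
    (fun t ht => p1 _ _ (by omega) (by omega) (by omega) (by omega))
    (fun s hs => p2 _ _ (by omega) (by omega) (by omega) (by omega))
    (fun s t hs ht u v => hP _ _ _ _ (by omega) (by omega) (by omega) (by omega) u v)
  intro x y k1 k2 k3 k4
  by_cases c1 : x < m
  · by_cases c2 : y < e
    · have := q1 (m - 1 - x) (e - 1 - y) (by omega) (by omega)
      try dsimp only at this
      rwa [show m - (m - 1 - x + 1) = x by omega, show e - (e - 1 - y + 1) = y by omega] at this
    · exact p1 x y k1 c1 (by omega) k4
  · by_cases c2 : y < e
    · exact p2 x y (by omega) k2 (by omega) c2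
    · have := q2 (x - m) (y - e) (by omega) (by omega)
      try dsimp only at this
      rwa [show e + (y - e + 1) - 1 = y by omega, show m + (x - m + 1) - 1 = x by omega] at this

theorem exists_min (f : ℕ → ℕ) (m b : ℕ) (h : m < b) :
    ∃ j, m ≤ j ∧ j < b ∧ ∀ i, m ≤ i → i < b → f j ≤ f i := by
  obtain ⟨j, hj, hm⟩ := Finset.exists_min_image (Finset.Ico m b) f ⟨m, by simp [h]⟩
  simp only [Finset.mem_Ico] at hj hm
  exact ⟨j, hj.1, hj.2, fun i h1 h2 => hm i ⟨h1, h2⟩⟩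

theorem sep_fill {n : ℕ} {P : ℕ → ℕ → Prop} (hP : Cl n P) {f : ℕ → ℕ}
    (hs : ∀ v, v < n → ∃ i, i < n ∧ f i = v) (hg : ∀ i, i < n → P i (f i))
    {a b : ℕ} (h : PSep f a b) :
    ∀ c d, b ≤ n → d ≤ n → (∀ i, i < n → ((a ≤ i ∧ i < b) ↔ (c ≤ f i ∧ f i < d))) →
    ∀ x y, a ≤ x → x < b → c ≤ y → y < d → P x y := by
  induction h with
  | one a =>
    intro c d hb hd hi x y k1 k2 k3 k4
    obtain ⟨i, hin, e⟩ := hs y (by omega)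
    have := hi i hin
    obtain rfl : i = x := by omega
    rw [← e]; exact hg i hin
  | inc a m b h1 h2 _ _ h3 ih1 ih2 =>
    intro c d hb hd hi
    obtain ⟨j, j1, j2, jm⟩ := exists_min f m b h2
    have ha := hi a (by omega)
    have haj := h3 a j (by omega) (by omega) (by omega) (by omega)
    have hj := hi j (by omega)
    refine fill_inc hP h1 h2 (e := f j) (by omega) (by omega) hb hd
      (ih1 _ _ (by omega) (by omega) ?_) (ih2 _ _ (by omega) (by omega) ?_)
    · intro i hin
      have u := hi i hin
      have v := h3 i j
      have w := jm i
      omega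
    · intro i hin
      have u := hi i hin
      have v := h3 i j
      have w := jm i
      omega
  | dec a m b h1 h2 _ _ h3 ih1 ih2 =>
    intro c d hb hd hi
    obtain ⟨j, j1, j2, jm⟩ := exists_min f a m h1
    have ha := hi m (by omega)
    have haj := h3 j m (by omega) (by omega) (by omega) (by omega)
    have hj := hi j (by omega)
    refine fill_dec hP h1 h2 (e := f j) (by omega) (by omega) hb hd
      (ih1 _ _ (by omega) (by omega) ?_) (ih2 _ _ (by omega) (by omega) ?_)
    · intro i hin
      have u := hi i hin
      have v := h3 j i
      have w := jm i
      omega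
    · intro i hin
      have u := hi i hin
      have v := h3 j i
      have w := jm i
      omega

theorem full_of_sep {n : ℕ} (π : Equiv.Perm (Fin n)) (h : PSep (extP π) 0 n) : Full π := by
  unfold Full
  rw [Set.eq_univ_iff_forall]
  rintro ⟨x, y⟩ S ⟨hG, hC⟩
  let P : ℕ → ℕ → Prop := fun x y => ∃ (hx : x < n) (hy : y < n), ((⟨x, hx⟩ : Fin n), (⟨y, hy⟩ : Fin n)) ∈ S
  have hP : Cl n P := by
    rintro x y x' y' hx hy e1 e2 ⟨u1, u2, u3⟩ ⟨v1, v2, v3⟩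
    refine ⟨hx, hy, hC _ ⟨_, u3, _, v3, ?_, ?_, ?_⟩⟩
    · simp only [ne_eq, Prod.mk.injEq, Fin.mk.injEq]; omega
    · simp only [Adj, Fin.mk.injEq, true_and]; omega
    · simp only [Adj, Fin.mk.injEq, true_and]; omega
  have hg : ∀ i, i < n → P i (extP π i) := by
    intro i hi
    refine ⟨hi, extP_lt π i hi, hG ?_⟩
    simp [graphOf, extP, hi]
  obtain ⟨_, _, r⟩ := sep_fill hP (extP_surj π) hg h 0 n le_rfl le_rfl
    (fun i hi => by have := extP_lt π i hi; omega) x y (by omega) x.2 (by omega) y.2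
  exact r

theorem full_iff {n : ℕ} (hn : 0 < n) (π : Equiv.Perm (Fin n)) : Full π ↔ PSep (extP π) 0 n :=
  ⟨sep_of_full hn π, full_of_sep π⟩

def DecAt (f : ℕ → ℕ) (N k : ℕ) : Prop := ∀ i j, i < k → k ≤ j → j < N → f i < f j
def SDecAt (f : ℕ → ℕ) (N k : ℕ) : Prop := ∀ i j, i < k → k ≤ j → j < N → f j < f i
def Dec (f : ℕ → ℕ) (N : ℕ) : Prop := ∃ k, 0 < k ∧ k < N ∧ DecAt f N k
def SDec (f : ℕ → ℕ) (N : ℕ) : Prop := ∃ k, 0 < k ∧ k < N ∧ SDecAt f N k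
def FirstDec (f : ℕ → ℕ) (N k : ℕ) : Prop := DecAt f N k ∧ ∀ j, 0 < j → j < k → ¬ DecAt f N j

open Classical in
noncomputable def cP (N : ℕ) : ℕ :=
  (Finset.univ.filter fun π : Equiv.Perm (Fin N) => PSep (extP π) 0 N).card
open Classical in
noncomputable def cA (N : ℕ) : ℕ :=
  (Finset.univ.filter fun π : Equiv.Perm (Fin N) => PSep (extP π) 0 N ∧ ¬ Dec (extP π) N).card
open Classical in
noncomputable def cD (N : ℕ) : ℕ :=
  (Finset.univ.filter fun π : Equiv.Perm (Fin N) => PSep (extP π) 0 N ∧ Dec (extP π) N).card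
open Classical in
noncomputable def cS (N : ℕ) : ℕ :=
  (Finset.univ.filter fun π : Equiv.Perm (Fin N) => PSep (extP π) 0 N ∧ SDec (extP π) N).card
open Classical in
noncomputable def cF (N k : ℕ) : ℕ :=
  (Finset.univ.filter fun π : Equiv.Perm (Fin N) =>
    PSep (extP π) 0 N ∧ FirstDec (extP π) N k).card

theorem numFull_eq (N : ℕ) (h : 0 < N) : numFull N = cP N := by
  classical
  unfold numFull cP
  rw [Nat.card_eq_fintype_card, Fintype.card_subtype]
  congr 1
  ext π
  simp [full_iff h]

theorem cP_eq (N : ℕ) : cP N = cD N + cA N := by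
  classical
  unfold cP cD cA
  rw [← Finset.card_filter_add_card_filter_not (s := Finset.univ.filter _)
    (fun π : Equiv.Perm (Fin N) => Dec (extP π) N), Finset.filter_filter, Finset.filter_filter]

theorem sep_dec {f : ℕ → ℕ} {N : ℕ} (hN : 2 ≤ N) (h : PSep f 0 N) : Dec f N ∨ SDec f N := by
  cases h with
  | one => omega
  | inc _ m _ h1 h2 _ _ h3 =>
    exact Or.inl ⟨m, h1, h2, fun i j a b c => h3 i j (by omega) a b c⟩
  | dec _ m _ h1 h2 _ _ h3 =>
    exact Or.inr ⟨m, h1, h2, fun i j a b c => h3 i j (by omega) a b c⟩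

theorem not_both {f : ℕ → ℕ} {N : ℕ} : Dec f N → ¬ SDec f N := by
  rintro ⟨k, k1, k2, k3⟩ ⟨l, l1, l2, l3⟩
  have := k3 0 (N - 1) k1 (by omega) (by omega)
  have := l3 0 (N - 1) l1 (by omega) (by omega)
  omega

theorem cA_eq_cS (N : ℕ) (hN : 2 ≤ N) : cA N = cS N := by
  classical
  unfold cA cS
  congr 1
  ext π
  simp only [Finset.mem_filter, Finset.mem_univ, true_and]
  constructor
  · rintro ⟨h1, h2⟩
    exact ⟨h1, (sep_dec hN h1).resolve_left h2⟩
  · rintro ⟨h1, h2⟩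
    exact ⟨h1, fun h => not_both h h2⟩

def rv {N : ℕ} (π : Equiv.Perm (Fin N)) : Equiv.Perm (Fin N) := π.trans Fin.revPerm

theorem rv_rv {N : ℕ} (π : Equiv.Perm (Fin N)) : rv (rv π) = π := by
  ext i; simp [rv]

theorem ext_rv {N : ℕ} (π : Equiv.Perm (Fin N)) (i : ℕ) (hi : i < N) :
    extP (rv π) i + extP π i + 1 = N := by
  simp only [extP, hi, dif_pos, rv, Equiv.trans_apply, Fin.revPerm_apply, Fin.val_rev]
  have := (π ⟨i, hi⟩).2
  omega

theorem sep_rv {N : ℕ} (π : Equiv.Perm (Fin N)) (h : PSep (extP π) 0 N) : PSep (extP (rv π)) 0 N := by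
  refine h.flip ?_
  intro i j _ hi _ hj hlt
  have := ext_rv π i hi; have := ext_rv π j hj
  omega

theorem cD_eq_cS (N : ℕ) : cD N = cS N := by
  classical
  unfold cD cS
  refine Finset.card_bij' (fun π _ => rv π) (fun π _ => rv π) ?_ ?_ ?_ ?_
  · intro π h
    simp only [Finset.mem_filter, Finset.mem_univ, true_and] at h ⊢
    obtain ⟨h1, k, k1, k2, k3⟩ := h
    refine ⟨sep_rv π h1, k, k1, k2, ?_⟩
    intro i j a b c
    have := k3 i j a b c
    have := ext_rv π i (by omega); have := ext_rv π j c
    omega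
  · intro π h
    simp only [Finset.mem_filter, Finset.mem_univ, true_and] at h ⊢
    obtain ⟨h1, k, k1, k2, k3⟩ := h
    refine ⟨sep_rv π h1, k, k1, k2, ?_⟩
    intro i j a b c
    have := k3 i j a b c
    have := ext_rv π i (by omega); have := ext_rv π j c
    omega
  · intro π _; exact rv_rv π
  · intro π _; exact rv_rv π

theorem cD_sum (N : ℕ) : cD (N + 1) = ∑ k ∈ Finset.range N, cF (N + 1) (k + 1) := by
  classical
  unfold cD cF
  rw [← Finset.card_biUnion]
  · congr 1
    ext π
    simp only [Finset.mem_filter, Finset.mem_univ, true_and, Finset.mem_biUnion, Finset.mem_range]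
    constructor
    · rintro ⟨h1, h2⟩
      have hk := Nat.find_spec h2
      refine ⟨Nat.find h2 - 1, by omega, h1, ?_⟩
      rw [Nat.sub_add_cancel (by omega)]
      refine ⟨hk.2.2, fun j j1 j2 j3 => Nat.find_min h2 j2 ⟨j1, by omega, j3⟩⟩
    · rintro ⟨k, hk, h1, h2, _⟩
      exact ⟨h1, k + 1, by omega, by omega, h2⟩
  · intro k _ l _ hkl
    rw [Function.onFun, Finset.disjoint_left]
    intro π h h'
    simp only [Finset.mem_filter, Finset.mem_univ, true_and] at h h'
    rcases lt_or_gt_of_ne hkl with c | c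
    · exact h'.2.2 _ (by omega) (by omega) h.2.1
    · exact h.2.2 _ (by omega) (by omega) h'.2.1

def glue {k m : ℕ} (σ : Equiv.Perm (Fin k)) (τ : Equiv.Perm (Fin m)) : Equiv.Perm (Fin (k + m)) :=
  finSumFinEquiv.permCongr (Equiv.Perm.sumCongr σ τ)

theorem glue_left {k m : ℕ} (σ : Equiv.Perm (Fin k)) (τ : Equiv.Perm (Fin m)) (i : ℕ) (hi : i < k) :
    extP (glue σ τ) i = extP σ i := by
  have h : i < k + m := by omega
  have e : (⟨i, h⟩ : Fin (k + m)) = Fin.castAdd m ⟨i, hi⟩ := rfl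
  simp only [extP, hi, h, dif_pos, e, glue, Equiv.permCongr_apply, finSumFinEquiv_symm_apply_castAdd]
  simp

theorem glue_right {k m : ℕ} (σ : Equiv.Perm (Fin k)) (τ : Equiv.Perm (Fin m)) (i : ℕ) (hi : i < m) :
    extP (glue σ τ) (k + i) = k + extP τ i := by
  have h : k + i < k + m := by omega
  have e : (⟨k + i, h⟩ : Fin (k + m)) = Fin.natAdd k ⟨i, hi⟩ := rfl
  simp only [extP, hi, h, dif_pos, e, glue, Equiv.permCongr_apply, finSumFinEquiv_symm_apply_natAdd]
  simp

theorem glue_right' {k m : ℕ} (σ : Equiv.Perm (Fin k)) (τ : Equiv.Perm (Fin m)) (i : ℕ)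
    (h1 : k ≤ i) (hi : i < k + m) : extP (glue σ τ) i = k + extP τ (i - k) := by
  rw [← glue_right σ τ _ (by omega), Nat.add_sub_cancel' h1]

theorem glue_inj {k m : ℕ} {σ σ' : Equiv.Perm (Fin k)} {τ τ' : Equiv.Perm (Fin m)}
    (h : glue σ τ = glue σ' τ') : σ = σ' ∧ τ = τ' := by
  constructor
  · ext i
    rw [← extP_fin, ← extP_fin, ← glue_left σ τ i i.2, h, glue_left _ _ i i.2]
  · ext i
    have h1 := glue_right σ τ i i.2
    rw [h, glue_right _ _ i i.2] at h1
    rw [← extP_fin, ← extP_fin]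
    omega

theorem decAt_lt {k m : ℕ} (π : Equiv.Perm (Fin (k + m))) (h : DecAt (extP π) (k + m) k)
    (i : ℕ) (hi : i < k) : extP π i < k := by
  by_contra hc
  -- the values at positions k, ..., k+m-1 lie in (extP π i, k+m)
  have h1 : ((Finset.Ico k (k + m)).image (extP π)).card = m := by
    rw [Finset.card_image_of_injOn]
    · simp
    · intro x hx y hy e
      simp only [Finset.coe_Ico, Set.mem_Ico] at hx hy
      exact extP_inj π x y hx.2 hy.2 e
  have h2 : (Finset.Ico k (k + m)).image (extP π) ⊆ Finset.Ico (k + 1) (k + m) := by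
    intro v hv
    simp only [Finset.mem_image, Finset.mem_Ico] at hv ⊢
    obtain ⟨j, hj, rfl⟩ := hv
    have := h i j hi hj.1 hj.2
    have := extP_lt π j hj.2
    omega
  have h3 := Finset.card_le_card h2
  have h4 := extP_lt π i (by omega)
  simp at h3
  omega

theorem glue_surj {k m : ℕ} (π : Equiv.Perm (Fin (k + m))) (h : DecAt (extP π) (k + m) k) :
    ∃ σ τ, glue σ τ = π := by
  have hm : Set.MapsTo (finSumFinEquiv.symm.permCongr π : Equiv.Perm (Fin k ⊕ Fin m))
      (Set.range Sum.inl) (Set.range Sum.inl) := by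
    rintro _ ⟨i, rfl⟩
    have h1 := decAt_lt π h i i.2
    have e : extP π i = (π (Fin.castAdd m i) : ℕ) := extP_fin π (Fin.castAdd m i)
    rw [e] at h1
    refine ⟨⟨_, h1⟩, ?_⟩
    simp only [Equiv.permCongr_apply, Equiv.symm_symm, finSumFinEquiv_apply_left]
    rw [Equiv.eq_symm_apply]
    rfl
  obtain ⟨⟨σ, τ⟩, e⟩ := Equiv.Perm.mem_sumCongrHom_range_of_perm_mapsTo_inl hm
  refine ⟨σ, τ, ?_⟩
  have e' : Equiv.Perm.sumCongr σ τ = finSumFinEquiv.symm.permCongr π := e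
  unfold glue
  rw [e']
  ext i
  simp

theorem glue_decAt {k m : ℕ} (σ : Equiv.Perm (Fin k)) (τ : Equiv.Perm (Fin m)) :
    DecAt (extP (glue σ τ)) (k + m) k := by
  intro i j h1 h2 h3
  rw [glue_left _ _ i h1, glue_right' _ _ j h2 h3]
  have := extP_lt σ i h1
  omega

theorem glue_first {k m : ℕ} (σ : Equiv.Perm (Fin k)) (τ : Equiv.Perm (Fin m)) :
    FirstDec (extP (glue σ τ)) (k + m) k ↔ ¬ Dec (extP σ) k := by
  constructor
  · rintro ⟨_, h⟩ ⟨l, l1, l2, l3⟩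
    refine h l l1 l2 ?_
    intro i j h1 h2 h3
    by_cases c : j < k
    · rw [glue_left _ _ i (by omega), glue_left _ _ j c]
      exact l3 i j h1 h2 c
    · exact glue_decAt σ τ i j (by omega) (by omega) h3
  · intro h
    refine ⟨glue_decAt σ τ, fun l l1 l2 l3 => h ⟨l, l1, l2, ?_⟩⟩
    intro i j h1 h2 h3
    have := l3 i j h1 h2 (by omega)
    rwa [glue_left _ _ i (by omega), glue_left _ _ j h3] at this

theorem glue_sep {k m : ℕ} (hk : 0 < k) (hm : 0 < m)
    (σ : Equiv.Perm (Fin k)) (τ : Equiv.Perm (Fin m)) :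
    PSep (extP (glue σ τ)) 0 (k + m) ↔ PSep (extP σ) 0 k ∧ PSep (extP τ) 0 m := by
  constructor
  · intro h
    constructor
    · have := (h.sub 0 k le_rfl hk (by omega)).down (g := extP σ) 0 le_rfl ?_
      · simpa using this
      · intro i j _ h1 _ h2 h3
        rw [glue_left _ _ i h1, glue_left _ _ j h2] at h3
        exact h3
    · have := (h.sub k (k + m) (by omega) (by omega) (by omega)).down (g := extP τ) k le_rfl ?_
      · simpa using this
      · intro i j h0 h1 h0' h2 h3
        rw [glue_right' _ _ i h0 h1, glue_right' _ _ j h0' h2] at h3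
        omega
  · rintro ⟨h1, h2⟩
    refine PSep.inc 0 k (k + m) hk (by omega) ?_ ?_ (fun i j _ a b c => glue_decAt σ τ i j a b c)
    · have := h1.up (g := extP (glue σ τ)) 0 ?_
      · simpa using this
      · intro i j _ h1 _ h2 h3
        rw [Nat.add_zero, Nat.add_zero, glue_left _ _ i h1, glue_left _ _ j h2]
        exact h3
    · have := h2.up (g := extP (glue σ τ)) k ?_
      · rwa [Nat.zero_add, show m + k = k + m from Nat.add_comm _ _] at this
      · intro i j _ h1 _ h2 h3
        rw [Nat.add_comm i, Nat.add_comm j, glue_right _ _ i h1, glue_right _ _ j h2]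
        omega

theorem cF_eq (k m : ℕ) (hk : 0 < k) (hm : 0 < m) : cF (k + m) k = cA k * cP m := by
  classical
  unfold cF cA cP
  rw [← Finset.card_product]
  symm
  refine Finset.card_bij (fun p _ => glue p.1 p.2) ?_ ?_ ?_
  · rintro ⟨σ, τ⟩ h
    simp only [Finset.mem_product, Finset.mem_filter, Finset.mem_univ, true_and] at h ⊢
    exact ⟨(glue_sep hk hm _ _).2 ⟨h.1.1, h.2⟩, (glue_first _ _).2 h.1.2⟩
  · rintro ⟨σ, τ⟩ _ ⟨σ', τ'⟩ _ h
    obtain ⟨rfl, rfl⟩ := glue_inj h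
    rfl
  · intro π h
    simp only [Finset.mem_filter, Finset.mem_univ, true_and] at h
    obtain ⟨σ, τ, rfl⟩ := glue_surj π h.2.1
    obtain ⟨h1, h2⟩ := (glue_sep hk hm _ _).1 h.1
    exact ⟨(σ, τ), by simp [h1, h2, (glue_first _ _).1 h.2], rfl⟩

theorem cP_one : cP 1 = 1 := by
  classical
  unfold cP
  rw [Finset.filter_true_of_mem (fun _ _ => PSep.one 0)]
  simp

theorem cA_one : cA 1 = 1 := by
  classical
  have h : cD 1 = 0 := by
    have := cD_sum 0
    simpa using this
  have := cP_eq 1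
  rw [cP_one, h] at this
  omega

theorem stmt_13 :
    numFull 1 = 1 ∧
    ∀ n : ℕ, numFull (n + 2) = numFull (n + 1) +
      ∑ j ∈ Finset.range (n + 1), numFull (j + 1) * numFull (n + 1 - j) := by
  refine ⟨by rw [numFull_eq 1 one_pos, cP_one], ?_⟩
  have two : ∀ N, 2 ≤ N → cP N = 2 * cA N := by
    intro N hN
    rw [cP_eq, cD_eq_cS, ← cA_eq_cS N hN]; ring
  intro n
  have e1 : ∑ j ∈ Finset.range (n + 1), numFull (j + 1) * numFull (n + 1 - j)
      = ∑ j ∈ Finset.range (n + 1), cP (j + 1) * cP (n + 1 - j) := by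
    refine Finset.sum_congr rfl fun j hj => ?_
    rw [Finset.mem_range] at hj
    rw [numFull_eq _ (by omega), numFull_eq _ (by omega)]
  have e2 : cD (n + 2) = ∑ j ∈ Finset.range (n + 1), cA (j + 1) * cP (n + 1 - j) := by
    rw [cD_sum (n + 1)]
    refine Finset.sum_congr rfl fun j hj => ?_
    rw [Finset.mem_range] at hj
    rw [← cF_eq _ _ (by omega) (by omega)]
    congr 1
    omega
  have e3 : cP (n + 2) = 2 * cD (n + 2) := by
    rw [two _ (by omega), cA_eq_cS _ (by omega), cD_eq_cS]
  rw [e1, numFull_eq _ (by omega), numFull_eq _ (by omega), e3, e2, Finset.sum_range_succ',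
    Finset.sum_range_succ', cP_one, cA_one, mul_add, Finset.mul_sum]
  have e4 : ∑ j ∈ Finset.range n, 2 * (cA (j + 1 + 1) * cP (n + 1 - (j + 1)))
      = ∑ j ∈ Finset.range n, cP (j + 1 + 1) * cP (n + 1 - (j + 1)) := by
    refine Finset.sum_congr rfl fun j hj => ?_
    rw [two (j + 1 + 1) (by omega)]; ring
  rw [e4]
  simp only [Nat.sub_zero]
  ring
end

section
/- Let n ≥ 1 and let π be a permutation of Fin n. Then π is no-growth (equivalently, the corresponding placement of n non-attacking kings, one per row and column, is valid) if and only if for every i with i + 1 < n, the integer difference (π (i+1) : ℤ) − (π i : ℤ) is neither 1 nor −1. -/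
theorem stmt_16 (n : ℕ) (hn : 1 ≤ n) (π : Equiv.Perm (Fin n)) :
    NoGrowth π ↔ ∀ (i : ℕ) (hi : i + 1 < n),
      (((π ⟨i + 1, hi⟩ : Fin n) : ℕ) : ℤ) - (((π ⟨i, by omega⟩ : Fin n) : ℕ) : ℤ) ≠ 1 ∧
      (((π ⟨i + 1, hi⟩ : Fin n) : ℕ) : ℤ) - (((π ⟨i, by omega⟩ : Fin n) : ℕ) : ℤ) ≠ -1 := by
  constructor
  · intro h i hi
    by_contra hc
    apply h (⟨i, by omega⟩, π ⟨i + 1, hi⟩)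
    have hv : (π ⟨i + 1, hi⟩ : ℕ) + 1 = (π ⟨i, by omega⟩ : ℕ) ∨
        (π ⟨i, by omega⟩ : ℕ) + 1 = (π ⟨i + 1, hi⟩ : ℕ) := by omega
    refine ⟨?_, (⟨i, by omega⟩, π ⟨i, by omega⟩), rfl, (⟨i + 1, hi⟩, π ⟨i + 1, hi⟩), rfl,
      ?_, Or.inl ⟨rfl, hv⟩, Or.inr ⟨rfl, Or.inl rfl⟩⟩
    · intro hm
      have hm' : π ⟨i + 1, hi⟩ = π ⟨i, by omega⟩ := hm
      rw [hm'] at hv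
      omega
    · intro he
      have := congrArg (fun p => (p.1 : ℕ)) he
      simp at this
  · intro h
    have H : ∀ x y : Fin n, (x : ℕ) + 1 = y →
        (π x : ℕ) + 1 ≠ π y ∧ (π y : ℕ) + 1 ≠ π x := by
      rintro ⟨x, hx⟩ ⟨y, hy⟩ hxy
      simp only at hxy
      subst hxy
      have := h x hy
      omega
    rintro ⟨a, b⟩ ⟨-, ⟨d, d'⟩, hd, ⟨e, e'⟩, he, hne, h1, h2⟩
    have hd : d' = π d := hd
    have he : e' = π e := he
    subst hd he
    simp only [Adj] at h1 h2
    rcases h1 with ⟨rfl, h1⟩ | ⟨rfl, h1⟩ <;> rcases h2 with ⟨h3, h2⟩ | ⟨h3, h2⟩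
    · subst h3; exact hne rfl
    · subst h3
      have := H a e
      have := H e a
      omega
    · subst h3
      have := H a d
      have := H d a
      omega
    · have := π.injective h3
      subst this; exact hne rfl
end

section
/- Let a m denote the number of no-growth permutations of Fin m and p i the number of full permutations of Fin i. Then for every n ≥ 1, n! = ∑_{c : Composition n} a (c.length) · ∏_{i ∈ c.blocks} p i, where the sum is over all compositions of n and c.blocks is the list of parts of c. -/
/-- The number of no-growth permutations of `Fin m` (solutions to the `m`-kings problem). -/
noncomputable def numNoGrowth (m : ℕ) : ℕ :=
  Nat.card {π : Equiv.Perm (Fin m) // NoGrowth π}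

def Pn {n : ℕ} (S : Set (Fin n × Fin n)) (p q : ℕ) : Prop :=
  ∃ (hp : p < n) (hq : q < n), ((⟨p, hp⟩ : Fin n), (⟨q, hq⟩ : Fin n)) ∈ S

theorem Pn_step {n : ℕ} {S : Set (Fin n × Fin n)} (hS : PercClosed S) {p q p' q' : ℕ}
    (hp : p' = p + 1 ∨ p = p' + 1) (hq : q' = q + 1 ∨ q = q' + 1)
    (h1 : Pn S p' q) (h2 : Pn S p q') : Pn S p q := by
  obtain ⟨a, b, h1⟩ := h1
  obtain ⟨a', b', h2⟩ := h2
  refine ⟨a', b, hS _ ⟨_, h1, _, h2, ?_, ?_, ?_⟩⟩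
  · intro h
    simp only [Prod.mk.injEq, Fin.mk.injEq] at h
    omega
  · right; simp only [true_and]; omega
  · left; simp only [true_and]; omega

theorem fill_asc {n : ℕ} {S : Set (Fin n × Fin n)} (hS : PercClosed S) {a m v k : ℕ}
    (hA : ∀ p q, a ≤ p → p < a + m → v ≤ q → q < v + m → Pn S p q)
    (hB : ∀ p q, a + m ≤ p → p < a + m + k → v + m ≤ q → q < v + m + k → Pn S p q) :
    ∀ p q, a ≤ p → p < a + m + k → v ≤ q → q < v + m + k → Pn S p q := by
  have key1 : ∀ d p q, a ≤ p → p < a + m → v + m ≤ q → q < v + m + k →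
      (a + m - p) + (q - (v + m)) ≤ d → Pn S p q := by
    intro d
    induction d with
    | zero => intros; omega
    | succ d ih =>
      intro p q h1 h2 h3 h4 h5
      refine Pn_step hS (p' := p + 1) (q' := q - 1) (by omega) (by omega) ?_ ?_
      · by_cases h : p + 1 < a + m
        · exact ih _ _ (by omega) h h3 h4 (by omega)
        · exact hB _ _ (by omega) (by omega) h3 h4
      · by_cases h : v + m ≤ q - 1
        · exact ih _ _ h1 h2 h (by omega) (by omega)
        · exact hA _ _ h1 h2 (by omega) (by omega)
  have key2 : ∀ d p q, a + m ≤ p → p < a + m + k → v ≤ q → q < v + m →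
      (p - (a + m)) + (v + m - q) ≤ d → Pn S p q := by
    intro d
    induction d with
    | zero => intros; omega
    | succ d ih =>
      intro p q h1 h2 h3 h4 h5
      refine Pn_step hS (p' := p - 1) (q' := q + 1) (by omega) (by omega) ?_ ?_
      · by_cases h : a + m ≤ p - 1
        · exact ih _ _ h (by omega) h3 h4 (by omega)
        · exact hA _ _ (by omega) (by omega) h3 h4
      · by_cases h : q + 1 < v + m
        · exact ih _ _ h1 h2 (by omega) h (by omega)
        · exact hB _ _ h1 h2 (by omega) (by omega)
  intro p q h1 h2 h3 h4
  by_cases hp : p < a + m <;> by_cases hq : q < v + m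
  · exact hA _ _ h1 hp h3 hq
  · exact key1 _ _ _ h1 hp (by omega) h4 le_rfl
  · exact key2 _ _ _ (by omega) h2 h3 hq le_rfl
  · exact hB _ _ (by omega) h2 (by omega) h4

theorem fill_desc {n : ℕ} {S : Set (Fin n × Fin n)} (hS : PercClosed S) {a m v k : ℕ}
    (hA : ∀ p q, a ≤ p → p < a + m → v + k ≤ q → q < v + k + m → Pn S p q)
    (hB : ∀ p q, a + m ≤ p → p < a + m + k → v ≤ q → q < v + k → Pn S p q) :
    ∀ p q, a ≤ p → p < a + m + k → v ≤ q → q < v + k + m → Pn S p q := by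
  have key1 : ∀ d p q, a ≤ p → p < a + m → v ≤ q → q < v + k →
      (a + m - p) + (v + k - q) ≤ d → Pn S p q := by
    intro d
    induction d with
    | zero => intros; omega
    | succ d ih =>
      intro p q h1 h2 h3 h4 h5
      refine Pn_step hS (p' := p + 1) (q' := q + 1) (by omega) (by omega) ?_ ?_
      · by_cases h : p + 1 < a + m
        · exact ih _ _ (by omega) h h3 h4 (by omega)
        · exact hB _ _ (by omega) (by omega) h3 h4
      · by_cases h : q + 1 < v + k
        · exact ih _ _ h1 h2 (by omega) h (by omega)
        · exact hA _ _ h1 h2 (by omega) (by omega)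
  have key2 : ∀ d p q, a + m ≤ p → p < a + m + k → v + k ≤ q → q < v + k + m →
      (p - (a + m)) + (q - (v + k)) ≤ d → Pn S p q := by
    intro d
    induction d with
    | zero =>
      intro p q h1 h2 h3 h4 h5
      exact Pn_step hS (p' := p - 1) (q' := q - 1) (by omega) (by omega)
        (hA _ _ (by omega) (by omega) (by omega) (by omega))
        (hB _ _ (by omega) (by omega) (by omega) (by omega))
    | succ d ih =>
      intro p q h1 h2 h3 h4 h5
      refine Pn_step hS (p' := p - 1) (q' := q - 1) (by omega) (by omega) ?_ ?_
      · by_cases h : a + m ≤ p - 1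
        · exact ih _ _ h (by omega) h3 h4 (by omega)
        · exact hA _ _ (by omega) (by omega) h3 h4
      · by_cases h : v + k ≤ q - 1
        · exact ih _ _ h1 h2 h (by omega) (by omega)
        · exact hB _ _ h1 h2 (by omega) (by omega)
  intro p q h1 h2 h3 h4
  by_cases hp : p < a + m <;> by_cases hq : q < v + k
  · exact key1 _ _ _ h1 hp h3 hq le_rfl
  · exact hA _ _ h1 hp (by omega) h4
  · exact hB _ _ (by omega) h2 h3 hq
  · exact key2 _ _ _ (by omega) h2 (by omega) h4 le_rfl

def Sq {n : ℕ} (π : Equiv.Perm (Fin n)) (a m v : ℕ) : Prop :=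
  (∀ j : Fin n, a ≤ j → (j : ℕ) < a + m → v ≤ π j ∧ (π j : ℕ) < v + m) ∧
  ∀ S : Set (Fin n × Fin n), PercClosed S →
    (∀ j : Fin n, a ≤ j → (j : ℕ) < a + m → (j, π j) ∈ S) →
    ∀ p q, a ≤ p → p < a + m → v ≤ q → q < v + m → Pn S p q

theorem Sq_merge_asc {n : ℕ} {π : Equiv.Perm (Fin n)} {a m v k : ℕ}
    (hA : Sq π a m v) (hB : Sq π (a + m) k (v + m)) : Sq π a (m + k) v := by
  constructor
  · intro j h1 h2
    have := hA.1 j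
    have := hB.1 j
    omega
  · intro S hS hg p q h1 h2 h3 h4
    exact fill_asc hS (hA.2 S hS (fun j _ _ => hg j (by omega) (by omega)))
      (hB.2 S hS (fun j _ _ => hg j (by omega) (by omega))) p q h1 (by omega) h3 (by omega)

theorem Sq_merge_desc {n : ℕ} {π : Equiv.Perm (Fin n)} {a m v k : ℕ}
    (hA : Sq π a m (v + k)) (hB : Sq π (a + m) k v) : Sq π a (m + k) v := by
  constructor
  · intro j h1 h2
    have := hA.1 j
    have := hB.1 j
    omega
  · intro S hS hg p q h1 h2 h3 h4
    exact fill_desc hS (hA.2 S hS (fun j _ _ => hg j (by omega) (by omega)))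
      (hB.2 S hS (fun j _ _ => hg j (by omega) (by omega))) p q h1 (by omega) h3 (by omega)

theorem Sq_single {n : ℕ} (π : Equiv.Perm (Fin n)) (j : Fin n) : Sq π j 1 (π j) := by
  constructor
  · intro i h1 h2
    have : i = j := Fin.ext (by omega)
    subst this
    omega
  · intro S _ hg p q h1 h2 h3 h4
    have e1 : p = j := by omega
    have e2 : q = π j := by omega
    subst e1 e2
    exact ⟨j.2, (π j).2, hg j le_rfl (by omega)⟩

/-- a full pattern fills its square -/
theorem Full_fills {n m : ℕ} {π : Equiv.Perm (Fin n)} {τ : Equiv.Perm (Fin m)} {a v : ℕ}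
    (_ha : a + m ≤ n) (hv : v + m ≤ n)
    (h : ∀ (x : Fin m) (j : Fin n), (j : ℕ) = a + x → (π j : ℕ) = v + τ x)
    (hτ : Full τ) {S : Set (Fin n × Fin n)} (hS : PercClosed S) (hg : graphOf π ⊆ S)
    {p q : Fin n} (h1 : a ≤ p) (h2 : (p : ℕ) < a + m) (h3 : v ≤ q) (h4 : (q : ℕ) < v + m) :
    (p, q) ∈ S := by
  let f : Fin m × Fin m → Fin n × Fin n :=
    fun x => (⟨a + x.1, by omega⟩, ⟨v + x.2, by omega⟩)
  have hf : Function.Injective f := by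
    rintro ⟨x, y⟩ ⟨x', y'⟩ hxy
    simp only [f, Prod.mk.injEq, Fin.mk.injEq] at hxy
    ext <;> simp <;> omega
  have hadj : ∀ x y, Adj x y → Adj (f x) (f y) := by
    intro x y hxy
    simp only [Adj, f, Fin.ext_iff] at hxy ⊢
    omega
  have hu : percClosure τ ⊆ f ⁻¹' S := by
    apply Set.sInter_subset_of_mem
    constructor
    · rintro ⟨x, y⟩ hxy
      simp only [graphOf, Set.mem_ofPred_eq] at hxy
      apply hg
      simp only [graphOf, Set.mem_ofPred_eq, f, Fin.ext_iff]
      rw [hxy, h x _ rfl]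
    · rintro c ⟨d, hd, e, he, hde, hcd, hce⟩
      exact hS _ ⟨_, hd, _, he, hf.ne hde, hadj _ _ hcd, hadj _ _ hce⟩
  rw [hτ] at hu
  have := hu (Set.mem_univ ((⟨p - a, by omega⟩, ⟨q - v, by omega⟩) : Fin m × Fin m))
  simp only [f, Set.mem_preimage] at this
  convert this <;> omega

theorem Sq_Full {n m : ℕ} {π : Equiv.Perm (Fin n)} {τ : Equiv.Perm (Fin m)} {a v : ℕ}
    (_ha : a + m ≤ n)
    (h : ∀ (x : Fin m) (j : Fin n), (j : ℕ) = a + x → (π j : ℕ) = v + τ x)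
    (hsq : Sq π a m v) : Full τ := by
  rw [Full, Set.eq_univ_iff_forall]
  rintro ⟨x, y⟩ S ⟨hg, hS⟩
  have := hsq.2 {c | ∃ x y : Fin m, (c.1 : ℕ) = a + x ∧ (c.2 : ℕ) = v + y ∧ (x, y) ∈ S} ?_ ?_
    (a + x) (v + y) (by omega) (by omega) (by omega) (by omega)
  · obtain ⟨_, _, x', y', h1, h2, h3⟩ := this
    simp only [Nat.add_left_cancel_iff, ← Fin.ext_iff] at h1 h2
    rw [h1, h2]; exact h3
  · rintro ⟨p, q⟩ ⟨⟨d1, d2⟩, ⟨x1, y1, hx1, hy1, hd⟩, ⟨e1, e2⟩, ⟨x2, y2, hx2, hy2, he⟩, hne, h1, h2⟩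
    simp only at hx1 hy1 hx2 hy2
    simp only [Adj, ne_eq, Prod.mk.injEq, Fin.ext_iff] at h1 h2 hne
    have : a ≤ p ∧ (p : ℕ) < a + m ∧ v ≤ q ∧ (q : ℕ) < v + m := by omega
    refine ⟨⟨p - a, by omega⟩, ⟨q - v, by omega⟩, by simp; omega, by simp; omega, ?_⟩
    refine hS _ ⟨_, hd, _, he, ?_, ?_, ?_⟩
    · simp only [ne_eq, Prod.mk.injEq, Fin.ext_iff]; omega
    · simp only [Adj, Fin.ext_iff]; omega
    · simp only [Adj, Fin.ext_iff]; omega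
  · intro j h1 h2
    have := h ⟨j - a, by omega⟩ j (by simp; omega)
    exact ⟨⟨j - a, by omega⟩, τ ⟨j - a, by omega⟩, by simp; omega, this, hg rfl⟩

theorem NoGrowth_ne {m : ℕ} {σ : Equiv.Perm (Fin m)} (h : NoGrowth σ) (k l : Fin m)
    (hkl : (k : ℕ) + 1 = l ∨ (l : ℕ) + 1 = k) (hs : (σ k : ℕ) + 1 = σ l ∨ (σ l : ℕ) + 1 = σ k) :
    False := by
  refine h (k, σ l) ⟨?_, (k, σ k), rfl, (l, σ l), rfl, ?_, ?_, ?_⟩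
  · simp only [graphOf, Set.mem_ofPred_eq, Fin.ext_iff]; omega
  · simp only [ne_eq, Prod.mk.injEq, Fin.ext_iff]; omega
  · simp only [Adj, Fin.ext_iff, true_and]; omega
  · simp only [Adj, Fin.ext_iff, true_and]; omega

theorem NoGrowth_of {m : ℕ} {σ : Equiv.Perm (Fin m)}
    (h : ∀ k l : Fin m, ¬ ((k : ℕ) + 1 = l ∧ ((σ k : ℕ) + 1 = σ l ∨ (σ l : ℕ) + 1 = σ k))) :
    NoGrowth σ := by
  rintro ⟨p, q⟩ ⟨-, ⟨d1, d2⟩, hd, ⟨e1, e2⟩, he, hne, h1, h2⟩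
  simp only [graphOf, Set.mem_ofPred_eq] at hd he
  subst hd he
  have hde : d1 ≠ e1 := fun hh => hne (by rw [hh])
  have hde' : σ d1 ≠ σ e1 := σ.injective.ne hde
  have := h d1 e1
  have := h e1 d1
  simp only [Adj, ne_eq, Fin.ext_iff] at h1 h2 hde hde'
  omega

section comp
variable {n : ℕ} (c : Composition n) (σ : Equiv.Perm (Fin c.length))

def offs (i : Fin c.length) : ℕ :=
  ∑ k ∈ Finset.univ.filter (fun k => σ k < σ i), c.blocksFun k

theorem offs_lt {k l : Fin c.length} (h : σ k < σ l) :
    offs c σ k + c.blocksFun k ≤ offs c σ l := by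
  unfold offs
  rw [add_comm, ← Finset.sum_insert (f := c.blocksFun) (by simp)]
  apply Finset.sum_le_sum_of_subset
  intro x
  simp only [Finset.mem_insert, Finset.mem_filter, Finset.mem_univ, true_and]
  rintro (rfl | hx)
  · exact h
  · exact hx.trans h

theorem offs_succ {k l : Fin c.length} (h : (σ k : ℕ) + 1 = σ l) :
    offs c σ k + c.blocksFun k = offs c σ l := by
  unfold offs
  rw [add_comm, ← Finset.sum_insert (f := c.blocksFun) (by simp)]
  congr 1
  ext x
  simp only [Finset.mem_insert, Finset.mem_filter, Finset.mem_univ, true_and]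
  rw [← σ.injective.eq_iff, Fin.ext_iff, Fin.lt_def, Fin.lt_def]
  omega

theorem offs_succ_conv {k l : Fin c.length} (h : offs c σ k + c.blocksFun k = offs c σ l) :
    (σ k : ℕ) + 1 = σ l := by
  have hk := c.one_le_blocksFun k
  have hl := c.one_le_blocksFun l
  rcases lt_trichotomy (σ k) (σ l) with h1 | h1 | h1
  · by_contra hne
    have h2 := Fin.lt_def.1 h1
    have hb : (σ k : ℕ) + 1 < c.length := by omega
    have e1 := offs_lt c σ (k := k) (l := σ.symm ⟨σ k + 1, hb⟩) (by simp [Fin.lt_def])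
    have e2 := offs_lt c σ (k := σ.symm ⟨σ k + 1, hb⟩) (l := l) (by simp [Fin.lt_def]; omega)
    have := c.one_le_blocksFun (σ.symm ⟨σ k + 1, hb⟩)
    omega
  · have := σ.injective h1
    subst this
    omega
  · have := offs_lt c σ h1
    omega

theorem offs_le (k : Fin c.length) : offs c σ k + c.blocksFun k ≤ n := by
  conv_rhs => rw [← c.sum_blocksFun]
  unfold offs
  rw [add_comm, ← Finset.sum_insert (f := c.blocksFun) (by simp)]
  exact Finset.sum_le_sum_of_subset (Finset.subset_univ _)

/-- the squares of the inflation are disjoint -/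
theorem offs_disj {k l : Fin c.length} {q : ℕ} (h1 : offs c σ k ≤ q)
    (h2 : q < offs c σ k + c.blocksFun k) (h3 : offs c σ l ≤ q)
    (h4 : q < offs c σ l + c.blocksFun l) : k = l := by
  rcases lt_trichotomy (σ k) (σ l) with h | h | h
  · have := offs_lt c σ h; omega
  · exact σ.injective h
  · have := offs_lt c σ h; omega

def Infl (τ : ∀ i, Equiv.Perm (Fin (c.blocksFun i))) (π : Equiv.Perm (Fin n)) : Prop :=
  ∀ i x, (π (c.embedding i x) : ℕ) = offs c σ i + τ i x

theorem exists_infl (τ : ∀ i, Equiv.Perm (Fin (c.blocksFun i))) : ∃ π, Infl c σ τ π := by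
  let g : (Σ i : Fin c.length, Fin (c.blocksFun i)) → Fin n :=
    fun y => ⟨offs c σ y.1 + τ y.1 y.2, by have := offs_le c σ y.1; omega⟩
  have hg : Function.Injective g := by
    rintro ⟨i, x⟩ ⟨j, y⟩ h
    simp only [g, Fin.mk.injEq] at h
    have : i = j := offs_disj c σ (q := offs c σ i + τ i x) (by omega) (by omega)
      (by omega) (by omega)
    subst this
    have h2 : τ i x = τ i y := Fin.ext (by omega)
    rw [(τ i).injective h2]
  have hb : Function.Bijective (g ∘ c.blocksFinEquiv.symm) :=
    Finite.injective_iff_bijective.1 (hg.comp c.blocksFinEquiv.symm.injective)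
  refine ⟨Equiv.ofBijective _ hb, ?_⟩
  intro i x
  have : c.embedding i x = c.blocksFinEquiv ⟨i, x⟩ := rfl
  rw [this, Equiv.ofBijective_apply, Function.comp_apply, Equiv.symm_apply_apply]

variable {c σ}

theorem infl_pt {τ : ∀ i, Equiv.Perm (Fin (c.blocksFun i))} {π : Equiv.Perm (Fin n)}
    (h : Infl c σ τ π) (i : Fin c.length) (x : Fin (c.blocksFun i)) (j : Fin n)
    (hj : (j : ℕ) = c.sizeUpTo i + x) : (π j : ℕ) = offs c σ i + τ i x := by
  have : j = c.embedding i x := Fin.ext (by rw [c.coe_embedding, hj])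
  rw [this, h]

theorem block_eq {i j : Fin c.length} {p : ℕ} (h1 : c.sizeUpTo i ≤ p)
    (h2 : p < c.sizeUpTo i + c.blocksFun i) (h3 : c.sizeUpTo j ≤ p)
    (h4 : p < c.sizeUpTo j + c.blocksFun j) : i = j := by
  rw [← c.sizeUpTo_succ'] at h2 h4
  rcases lt_trichotomy i j with h | h | h
  · have := c.monotone_sizeUpTo (show (i : ℕ) + 1 ≤ j from h); omega
  · exact h
  · have := c.monotone_sizeUpTo (show (j : ℕ) + 1 ≤ i from h); omega

theorem block_ex (c : Composition n) (p : Fin n) : ∃ i : Fin c.length, c.sizeUpTo i ≤ p ∧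
    (p : ℕ) < c.sizeUpTo i + c.blocksFun i := by
  refine ⟨c.index p, c.sizeUpTo_index_le p, ?_⟩
  rw [← c.sizeUpTo_succ']
  exact c.lt_sizeUpTo_index_succ p

theorem block_adj {i j : Fin c.length} {p : ℕ} (h1 : c.sizeUpTo i ≤ p)
    (h2 : p < c.sizeUpTo i + c.blocksFun i) (h3 : c.sizeUpTo j ≤ p + 1)
    (h4 : p + 1 < c.sizeUpTo j + c.blocksFun j) : i = j ∨ (i : ℕ) + 1 = j := by
  rw [← c.sizeUpTo_succ'] at h2 h4
  rcases lt_trichotomy i j with h | h | h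
  · right
    by_contra hne
    have hl := Fin.lt_def.1 h
    have := c.monotone_sizeUpTo (show (i : ℕ) + 1 + 1 ≤ j by omega)
    have := c.sizeUpTo_strict_mono (i := i + 1) (by omega)
    omega
  · exact Or.inl h
  · have := c.monotone_sizeUpTo (show (j : ℕ) + 1 ≤ i from h); omega

theorem closure_infl {τ : ∀ i, Equiv.Perm (Fin (c.blocksFun i))} {π : Equiv.Perm (Fin n)}
    (h : Infl c σ τ π) (hσ : NoGrowth σ) (hτ : ∀ i, Full (τ i)) (p q : Fin n) :
    (p, q) ∈ percClosure π ↔ ∃ i : Fin c.length, (c.sizeUpTo i ≤ p ∧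
      (p : ℕ) < c.sizeUpTo i + c.blocksFun i) ∧ (offs c σ i ≤ q ∧
      (q : ℕ) < offs c σ i + c.blocksFun i) := by
  constructor
  · intro hpq
    refine hpq {z | ∃ i : Fin c.length, (c.sizeUpTo i ≤ z.1 ∧
      (z.1 : ℕ) < c.sizeUpTo i + c.blocksFun i) ∧ (offs c σ i ≤ z.2 ∧
      (z.2 : ℕ) < offs c σ i + c.blocksFun i)} ⟨?_, ?_⟩
    · rintro ⟨p, q⟩ hz
      simp only [graphOf, Set.mem_ofPred_eq] at hz
      subst hz
      obtain ⟨i, h1, h2⟩ := block_ex c p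
      have := infl_pt h i ⟨p - c.sizeUpTo i, by omega⟩ p (by simp; omega)
      exact ⟨i, ⟨h1, h2⟩, by simp only; omega, by simp only; omega⟩
    · rintro ⟨p, q⟩ ⟨⟨d1, d2⟩, ⟨i, ⟨hi1, hi2⟩, hi3, hi4⟩, ⟨e1, e2⟩, ⟨j, ⟨hj1, hj2⟩, hj3, hj4⟩,
        hne, h1, h2⟩
      simp only at hi1 hi2 hi3 hi4 hj1 hj2 hj3 hj4
      -- main case
      have main : ∀ (i j : Fin c.length) (p' q' : ℕ), c.sizeUpTo i ≤ p →
          (p : ℕ) < c.sizeUpTo i + c.blocksFun i → offs c σ i ≤ q' →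
          q' < offs c σ i + c.blocksFun i → c.sizeUpTo j ≤ p' →
          p' < c.sizeUpTo j + c.blocksFun j → offs c σ j ≤ q →
          (q : ℕ) < offs c σ j + c.blocksFun j → (p' = p + 1 ∨ (p : ℕ) = p' + 1) →
          (q' = q + 1 ∨ (q : ℕ) = q' + 1) → i = j := by
        intro i j p' q' a1 a2 a3 a4 b1 b2 b3 b4 hp hq
        by_contra hij
        have hidx : (i : ℕ) + 1 = j ∨ (j : ℕ) + 1 = i := by
          rcases hp with rfl | hp
          · rcases block_adj a1 a2 b1 b2 with hh | hh
            · exact absurd hh hij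
            · exact Or.inl hh
          · rcases block_adj b1 b2 (by omega : c.sizeUpTo i ≤ p' + 1) (by omega) with hh | hh
            · exact absurd hh.symm hij
            · exact Or.inr hh
        have hsig : (σ i : ℕ) + 1 = σ j ∨ (σ j : ℕ) + 1 = σ i := by
          have n1 : ¬ (offs c σ i ≤ q ∧ (q : ℕ) < offs c σ i + c.blocksFun i) :=
            fun hh => hij (offs_disj c σ hh.1 hh.2 b3 b4)
          have n2 : ¬ (offs c σ j ≤ q' ∧ (q' : ℕ) < offs c σ j + c.blocksFun j) :=
            fun hh => hij (offs_disj c σ a3 a4 hh.1 hh.2)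
          rcases hq with hq | hq
          · right; apply offs_succ_conv; omega
          · left; apply offs_succ_conv; omega
        exact NoGrowth_ne hσ i j hidx hsig
      simp only [Adj, ne_eq, Prod.mk.injEq, Fin.ext_iff] at h1 h2 hne
      simp only [Set.mem_ofPred_eq]
      rcases h1 with ⟨x1, y1⟩ | ⟨x1, y1⟩ <;> rcases h2 with ⟨x2, y2⟩ | ⟨x2, y2⟩
      · have : i = j := block_eq hi1 hi2 (by omega) (by omega)
        subst this
        exact ⟨i, by omega, by omega⟩
      · have : i = j := main i j e1 d2 (by omega) (by omega) (by omega) (by omega) (by omega)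
          (by omega) (by omega) (by omega) (by omega) (by omega)
        subst this
        exact ⟨i, by omega, by omega⟩
      · have : j = i := main j i d1 e2 (by omega) (by omega) (by omega) (by omega) (by omega)
          (by omega) (by omega) (by omega) (by omega) (by omega)
        subst this
        exact ⟨j, by omega, by omega⟩
      · have : i = j := offs_disj c σ hi3 hi4 (by omega) (by omega)
        subst this
        exact ⟨i, by omega, by omega⟩
  · rintro ⟨i, ⟨h1, h2⟩, h3, h4⟩ S ⟨hg, hS⟩
    refine Full_fills (by have := c.sizeUpTo_le (i + 1); rw [c.sizeUpTo_succ'] at this; exact this)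
      (offs_le c σ i) (infl_pt h i) (hτ i) hS hg h1 h2 h3 h4

theorem mem_bd {τ : ∀ i, Equiv.Perm (Fin (c.blocksFun i))} {π : Equiv.Perm (Fin n)}
    (h : Infl c σ τ π) (hσ : NoGrowth σ) (hτ : ∀ i, Full (τ i)) (t : Fin (n + 1)) :
    t ∈ c.boundaries ↔ ((t : ℕ) = 0 ∨ (t : ℕ) = n ∨ ∃ (p p' : Fin n), (p : ℕ) + 1 = t ∧
      (p' : ℕ) = t ∧ (p', π p) ∉ percClosure π) := by
  have hb : t ∈ c.boundaries ↔ ∃ k ≤ c.length, c.sizeUpTo k = t := by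
    simp only [Composition.boundaries, Finset.mem_map, Finset.mem_univ, true_and]
    constructor
    · rintro ⟨k, rfl⟩
      exact ⟨k, by omega, rfl⟩
    · rintro ⟨k, hk, hh⟩
      exact ⟨⟨k, by omega⟩, Fin.ext hh⟩
  rw [hb]
  by_cases h0 : (t : ℕ) = 0
  · simp only [h0, true_or, iff_true]
    exact ⟨0, by omega, c.sizeUpTo_zero⟩
  by_cases h1 : (t : ℕ) = n
  · simp only [h1, true_or, or_true, iff_true]
    exact ⟨_, le_rfl, c.sizeUpTo_length⟩
  simp only [h0, h1, false_or]
  obtain ⟨p, hp⟩ : ∃ p : Fin n, (p : ℕ) + 1 = t := ⟨⟨t - 1, by omega⟩, by simp; omega⟩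
  obtain ⟨p', hp'⟩ : ∃ p : Fin n, (p : ℕ) = t := ⟨⟨t, by omega⟩, by simp⟩
  obtain ⟨i, hi1, hi2⟩ := block_ex c p
  have hπ := infl_pt h i ⟨p - c.sizeUpTo i, by omega⟩ p (by simp; omega)
  have hmem : (p', π p) ∈ percClosure π ↔ (t : ℕ) < c.sizeUpTo i + c.blocksFun i := by
    rw [closure_infl h hσ hτ]
    constructor
    · rintro ⟨j, ⟨a1, a2⟩, a3, a4⟩
      have : i = j := offs_disj c σ (q := π p) (by omega) (by omega) a3 a4
      subst this
      omega
    · intro hh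
      exact ⟨i, by omega, by omega⟩
  have : (∃ k ≤ c.length, c.sizeUpTo k = t) ↔ (t : ℕ) = c.sizeUpTo i + c.blocksFun i := by
    constructor
    · rintro ⟨k, hk, hkt⟩
      rw [← c.sizeUpTo_succ'] at hi2 ⊢
      rcases Nat.lt_or_ge k (i + 1) with hlt | hge
      · have := c.monotone_sizeUpTo (show k ≤ i by omega); omega
      · have := c.monotone_sizeUpTo hge; omega
    · intro hh
      exact ⟨i + 1, by omega, by rw [c.sizeUpTo_succ', hh]⟩
  rw [this]
  constructor
  · intro hh
    exact ⟨p, p', hp, hp', by rw [hmem]; omega⟩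
  · rintro ⟨r, r', hr, hr', hh⟩
    have e1 : r = p := Fin.ext (by omega)
    have e2 : r' = p' := Fin.ext (by omega)
    subst e1 e2
    rw [hmem] at hh
    omega

end comp

theorem perm_eq_of_lt {m : ℕ} {σ σ' : Equiv.Perm (Fin m)}
    (h : ∀ i j, σ i < σ j → σ' i < σ' j) : σ = σ' := by
  have hm : StrictMono (σ' ∘ σ.symm) := by
    intro a b hab
    apply h
    simpa using hab
  have := Subsingleton.elim (StrictMono.orderIsoOfSurjective _ hm
    (σ'.surjective.comp σ.symm.surjective)) (OrderIso.refl _)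
  ext i
  have := congrArg (fun f => f (σ i)) this
  simp at this
  rw [this]

theorem infl_unique {n : ℕ} {c c' : Composition n} {σ : Equiv.Perm (Fin c.length)}
    {σ' : Equiv.Perm (Fin c'.length)}
    {τ : ∀ i, Equiv.Perm (Fin (c.blocksFun i))} {τ' : ∀ i, Equiv.Perm (Fin (c'.blocksFun i))}
    {π : Equiv.Perm (Fin n)}
    (h : Infl c σ τ π) (hσ : NoGrowth σ) (hτ : ∀ i, Full (τ i))
    (h' : Infl c' σ' τ' π) (hσ' : NoGrowth σ') (hτ' : ∀ i, Full (τ' i)) : c = c' := by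
  apply (compositionEquiv n).injective
  apply CompositionAsSet.ext
  show c.boundaries = c'.boundaries
  ext t
  rw [mem_bd h hσ hτ, mem_bd h' hσ' hτ']

theorem infl_unique' {n : ℕ} {c : Composition n} {σ σ' : Equiv.Perm (Fin c.length)}
    {τ τ' : ∀ i, Equiv.Perm (Fin (c.blocksFun i))}
    {π : Equiv.Perm (Fin n)} (h : Infl c σ τ π) (h' : Infl c σ' τ' π) : σ = σ' ∧ τ = τ' := by
  have hb := c.one_le_blocksFun
  have hs : σ = σ' := by
    apply perm_eq_of_lt
    intro i j hij
    have h1 := offs_lt c σ hij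
    by_contra hn
    have h2 : σ' j < σ' i := lt_of_le_of_ne (not_lt.1 hn) (by
      intro hh
      have := σ'.injective hh
      subst this
      exact lt_irrefl _ hij)
    have h3 := offs_lt c σ' h2
    have a1 := h i ⟨0, hb i⟩
    have a2 := h j ⟨0, hb j⟩
    have a3 := h' i ⟨0, hb i⟩
    have a4 := h' j ⟨0, hb j⟩
    omega
  refine ⟨hs, ?_⟩
  subst hs
  funext i
  ext x
  have a1 := h i x
  have a2 := h' i x
  omega

def GoodB {n : ℕ} (π : Equiv.Perm (Fin n)) (B : Finset (Fin (n + 1))) : Prop :=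
  0 ∈ B ∧ Fin.last n ∈ B ∧ ∀ a ∈ B, ∀ b ∈ B, a < b → (∀ t ∈ B, t ≤ a ∨ b ≤ t) →
    ∃ v, Sq π a (b - a) v

theorem goodB_univ {n : ℕ} (π : Equiv.Perm (Fin n)) : GoodB π Finset.univ := by
  refine ⟨Finset.mem_univ _, Finset.mem_univ _, ?_⟩
  intro a _ b _ hab h
  have hab' := Fin.lt_def.1 hab
  have hb : (b : ℕ) - a = 1 := by
    have := h ⟨a + 1, by omega⟩ (Finset.mem_univ _)
    simp only [Fin.le_def] at this
    omega
  rw [hb]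
  exact ⟨_, Sq_single π ⟨a, by omega⟩⟩

theorem goodB_erase {n : ℕ} {π : Equiv.Perm (Fin n)} {B : Finset (Fin (n + 1))} (h : GoodB π B)
    {a t b : Fin (n + 1)} (ha : a ∈ B) (ht : t ∈ B) (hb : b ∈ B) (hat : a < t) (htb : t < b)
    (h1 : ∀ s ∈ B, s ≤ a ∨ t ≤ s) (h2 : ∀ s ∈ B, s ≤ t ∨ b ≤ s) {v : ℕ}
    (hv : Sq π a (b - a) v) : GoodB π (B.erase t) := by
  refine ⟨Finset.mem_erase.2 ⟨?_, h.1⟩, Finset.mem_erase.2 ⟨?_, h.2.1⟩, ?_⟩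
  · rintro rfl; exact absurd hat (Fin.not_lt_zero _)
  · rintro rfl; exact absurd htb (not_lt.2 (Fin.le_last _))
  · intro a' ha' b' hb' hab hc
    rw [Finset.mem_erase] at ha' hb'
    by_cases hin : a' < t ∧ t < b'
    · have e1 : a' = a := by
        rcases hc a (Finset.mem_erase.2 ⟨hat.ne, ha⟩) with hh | hh
        · rcases h1 a' ha'.2 with h3 | h3
          · exact le_antisymm h3 hh
          · exact absurd hin.1 (not_lt.2 h3)
        · exact absurd (hat.trans hin.2) (not_lt.2 hh)
      have e2 : b' = b := by
        rcases hc b (Finset.mem_erase.2 ⟨htb.ne', hb⟩) with hh | hh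
        · exact absurd (hin.1.trans htb) (not_lt.2 hh)
        · rcases h2 b' hb'.2 with h3 | h3
          · exact absurd hin.2 (not_lt.2 h3)
          · exact le_antisymm hh h3
      subst e1 e2
      exact ⟨v, hv⟩
    · apply h.2.2 a' ha'.2 b' hb'.2 hab
      intro s hs
      by_cases hst : s = t
      · subst hst
        by_contra! hcon
        exact hin hcon
      · exact hc s (Finset.mem_erase.2 ⟨hst, hs⟩)

theorem exists_sq {n : ℕ} (π : Equiv.Perm (Fin n)) : ∃ (c : Composition n) (v : Fin c.length → ℕ),
    (∀ i : Fin c.length, Sq π (c.sizeUpTo i) (c.blocksFun i) (v i)) ∧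
    ∀ i j : Fin c.length, (i : ℕ) + 1 = j →
      ¬ (v i + c.blocksFun i = v j ∨ v j + c.blocksFun j = v i) := by
  classical
  obtain ⟨B, hB, hmin⟩ := Finset.exists_min_image
    (Finset.univ.filter (fun B : Finset (Fin (n + 1)) => GoodB π B)) Finset.card
    ⟨Finset.univ, by simpa using goodB_univ π⟩
  simp only [Finset.mem_filter, Finset.mem_univ, true_and] at hB hmin
  obtain ⟨c, hc⟩ : ∃ c : Composition n, c.boundaries = B :=
    ⟨(⟨B, hB.1, hB.2.1⟩ : CompositionAsSet n).toComposition,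
      CompositionAsSet.toComposition_boundaries _⟩
  subst hc
  have hm : ∀ k, c.boundary k ∈ c.boundaries := by
    intro k; simp [Composition.boundaries]
  have hcons : ∀ i : Fin c.length, ∀ s ∈ c.boundaries,
      s ≤ c.boundary i.castSucc ∨ c.boundary i.succ ≤ s := by
    intro i s hs
    simp only [Composition.boundaries, Finset.mem_map, Finset.mem_univ, true_and] at hs
    obtain ⟨k, rfl⟩ := hs
    simp only [RelEmbedding.coe_toEmbedding, OrderEmbedding.le_iff_le, Fin.le_def]
    simp
    omega
  have hlt : ∀ i : Fin c.length, c.boundary i.castSucc < c.boundary i.succ := by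
    intro i; simp
  have hv1 : ∀ i : Fin c.length, (c.boundary i.castSucc : ℕ) = c.sizeUpTo i := fun i => rfl
  have hv2 : ∀ i : Fin c.length, (c.boundary i.succ : ℕ) = c.sizeUpTo i + c.blocksFun i :=
    fun i => by rw [← c.sizeUpTo_succ']; rfl
  have hex : ∀ i : Fin c.length, ∃ v, Sq π (c.sizeUpTo i) (c.blocksFun i) v := by
    intro i
    have := hB.2.2 _ (hm i.castSucc) _ (hm i.succ) (hlt i) (hcons i)
    rw [hv1, hv2, Nat.add_sub_cancel_left] at this
    exact this
  choose v hv using hex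
  refine ⟨c, v, hv, ?_⟩
  intro i j hij hadj
  have hsj : c.sizeUpTo j = c.sizeUpTo i + c.blocksFun i := by
    rw [← hij, c.sizeUpTo_succ']
  have hije : i.succ = j.castSucc := Fin.ext (by simp [hij])
  have hbig : ∃ w, Sq π (c.sizeUpTo i) (c.blocksFun i + c.blocksFun j) w := by
    have h1 := hv i
    have h2 := hv j
    rw [hsj] at h2
    rcases hadj with hh | hh
    · rw [← hh] at h2
      exact ⟨_, Sq_merge_asc h1 h2⟩
    · rw [← hh] at h1
      exact ⟨_, Sq_merge_desc h1 h2⟩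
  obtain ⟨w, hw⟩ := hbig
  have hg : GoodB π (c.boundaries.erase (c.boundary i.succ)) := by
    refine goodB_erase hB (hm i.castSucc) (hm i.succ) (hm j.succ) (hlt i)
      (by rw [hije]; exact hlt j) (hcons i) (by rw [hije]; exact hcons j) (v := w) ?_
    rw [hv1, hv2, hsj, Nat.add_assoc, Nat.add_sub_cancel_left]
    exact hw
  have := hmin _ hg
  have := Finset.card_erase_lt_of_mem (hm i.succ)
  omega

theorem exists_rank {m : ℕ} (v : Fin m → ℕ) (hv : Function.Injective v) :
    ∃ σ : Equiv.Perm (Fin m), ∀ i j, σ i < σ j ↔ v i < v j := by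
  have hm : StrictMono (v ∘ Tuple.sort v) :=
    (Tuple.monotone_sort v).strictMono_of_injective (hv.comp (Tuple.sort v).injective)
  refine ⟨(Tuple.sort v).symm, fun i j => ?_⟩
  rw [← hm.lt_iff_lt]
  simp

theorem exists_decomp {n : ℕ} (π : Equiv.Perm (Fin n)) : ∃ (c : Composition n)
    (σ : Equiv.Perm (Fin c.length)) (τ : ∀ i, Equiv.Perm (Fin (c.blocksFun i))),
    NoGrowth σ ∧ (∀ i, Full (τ i)) ∧ Infl c σ τ π := by
  obtain ⟨c, v, hsq, hadj⟩ := exists_sq π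
  have hτ : ∀ i : Fin c.length, ∃ τ : Equiv.Perm (Fin (c.blocksFun i)),
      ∀ x, (π (c.embedding i x) : ℕ) = v i + τ x := by
    intro i
    have hb : ∀ x : Fin (c.blocksFun i), v i ≤ π (c.embedding i x) ∧
        (π (c.embedding i x) : ℕ) < v i + c.blocksFun i := by
      intro x
      have := c.coe_embedding i x
      exact (hsq i).1 (c.embedding i x) (by omega) (by omega)
    let f : Fin (c.blocksFun i) → Fin (c.blocksFun i) :=
      fun x => ⟨π (c.embedding i x) - v i, by have := hb x; omega⟩
    have hf : Function.Injective f := by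
      intro x y hxy
      simp only [f, Fin.mk.injEq] at hxy
      have h1 := hb x
      have h2 := hb y
      have : π (c.embedding i x) = π (c.embedding i y) := Fin.ext (by omega)
      exact (c.embedding i).injective (π.injective this)
    refine ⟨Equiv.ofBijective f (Finite.injective_iff_bijective.1 hf), fun x => ?_⟩
    have := hb x
    simp only [Equiv.ofBijective_apply, f]
    omega
  choose τ hτ using hτ
  have hpos := c.one_le_blocksFun
  -- each value `v i + y` is attained in block `i`
  have hatt : ∀ i (y : Fin (c.blocksFun i)), (π (c.embedding i ((τ i).symm y)) : ℕ) = v i + y := by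
    intro i y; rw [hτ]; simp
  have hemb : ∀ i j x y, c.embedding i x = c.embedding j y → i = j := by
    intro i j x y h
    have := congrArg c.index h
    simpa [c.index_embedding] using this
  have hdis : ∀ i j (x : Fin (c.blocksFun i)) (y : Fin (c.blocksFun j)),
      v i + x = v j + y → i = j := by
    intro i j x y h
    have : π (c.embedding i ((τ i).symm x)) = π (c.embedding j ((τ j).symm y)) :=
      Fin.ext (by rw [hatt, hatt, h])
    exact hemb _ _ _ _ (π.injective this)
  have hvinj : Function.Injective v := by
    intro i j h
    exact hdis i j ⟨0, hpos i⟩ ⟨0, hpos j⟩ (by simpa using h)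
  obtain ⟨σ, hσ⟩ := exists_rank v hvinj
  have hlt : ∀ i k (x : Fin (c.blocksFun k)), (π (c.embedding k x) : ℕ) < v i ↔ v k < v i := by
    intro i k x
    rw [hτ]
    constructor
    · intro h; omega
    · intro h
      by_contra hn
      have := hdis i k ⟨0, hpos i⟩ ⟨v i - v k, by omega⟩ (by simp; omega)
      subst this
      omega
  have hoff : ∀ i, offs c σ i = v i := by
    intro i
    have hvn : v i < n := by
      have := hatt i ⟨0, hpos i⟩
      simp only [add_zero] at this
      omega
    have h1 : (∑ j : Fin n, if (j : ℕ) < v i then 1 else 0) = v i := by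
      rw [← Finset.card_filter]
      have : (Finset.univ.filter fun j : Fin n => (j : ℕ) < v i) = Finset.Iio ⟨v i, hvn⟩ := by
        ext j; simp [Fin.lt_def]
      rw [this, Fin.card_Iio]
    rw [← Equiv.sum_comp π, ← Equiv.sum_comp c.blocksFinEquiv, Fintype.sum_sigma] at h1
    rw [← h1, offs, Finset.sum_filter]
    apply Finset.sum_congr rfl
    intro k _
    have : ∀ x : Fin (c.blocksFun k),
        (if ((π (c.blocksFinEquiv ⟨k, x⟩) : Fin n) : ℕ) < v i then 1 else 0)
          = if σ k < σ i then 1 else 0 := by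
      intro x
      have := hlt i k x
      rw [← hσ] at this
      exact if_congr this rfl rfl
    rw [Finset.sum_congr rfl (fun x _ => this x)]
    split_ifs <;> simp
  refine ⟨c, σ, τ, ?_, ?_, ?_⟩
  · apply NoGrowth_of
    rintro k l ⟨hkl, hs⟩
    apply hadj k l hkl
    rw [← hoff, ← hoff]
    rcases hs with hs | hs
    · exact Or.inl (offs_succ c σ hs)
    · exact Or.inr (offs_succ c σ hs)
  · intro i
    refine Sq_Full (π := π) ?_ ?_ (hsq i)
    · have := c.sizeUpTo_le (i + 1); rw [c.sizeUpTo_succ'] at this; exact this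
    · intro x j hj
      have : j = c.embedding i x := Fin.ext (by rw [c.coe_embedding, hj])
      rw [this, hτ]
  · intro i x
    rw [hoff, hτ]

theorem stmt_17 (n : ℕ) (hn : 1 ≤ n) :
    Nat.factorial n =
      ∑ c : Composition n, numNoGrowth c.length * (c.blocks.map numFull).prod := by
  classical
  let T := Σ c : Composition n, {σ : Equiv.Perm (Fin c.length) // NoGrowth σ} ×
    (∀ i, {τ : Equiv.Perm (Fin (c.blocksFun i)) // Full τ})
  have hex : ∀ t : T, ∃ π, Infl t.1 t.2.1.1 (fun i => (t.2.2 i).1) π :=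
    fun t => exists_infl _ _ _
  choose F hF using hex
  have hbij : Function.Bijective F := by
    constructor
    · rintro ⟨c, ⟨σ, hσ⟩, τ⟩ ⟨c', ⟨σ', hσ'⟩, τ'⟩ h
      have h1 := hF ⟨c, ⟨σ, hσ⟩, τ⟩
      have h2 := hF ⟨c', ⟨σ', hσ'⟩, τ'⟩
      rw [← h] at h2
      simp only at h1 h2
      have := infl_unique h1 hσ (fun i => (τ i).2) h2 hσ' (fun i => (τ' i).2)
      subst this
      obtain ⟨e1, e2⟩ := infl_unique' h1 h2
      subst e1
      have : τ = τ' := by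
        funext i
        exact Subtype.ext (congrFun e2 i)
      subst this
      rfl
    · intro π
      obtain ⟨c, σ, τ, hσ, hτ, h⟩ := exists_decomp π
      refine ⟨⟨c, ⟨σ, hσ⟩, fun i => ⟨τ i, hτ i⟩⟩, ?_⟩
      have h2 := hF ⟨c, ⟨σ, hσ⟩, fun i => ⟨τ i, hτ i⟩⟩
      apply Equiv.ext
      intro j
      obtain ⟨⟨i, x⟩, rfl⟩ := c.blocksFinEquiv.surjective j
      exact Fin.ext ((h2 i x).trans (h i x).symm)
  have hcard := Nat.card_eq_of_bijective F hbij
  rw [Nat.card_eq_fintype_card (α := Equiv.Perm (Fin n)), Fintype.card_perm, Fintype.card_fin]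
    at hcard
  rw [← hcard, Nat.card_sigma]
  apply Finset.sum_congr rfl
  intro c _
  rw [Nat.card_prod, Nat.card_pi]
  congr 1
  conv_rhs => rw [← c.ofFn_blocksFun]
  rw [List.map_ofFn, List.prod_ofFn]
  rfl
end

section
/- Let a n denote the number of no-growth permutations of Fin n (equivalently, the number of solutions of the n-kings problem). Then for every n ≥ 1, as rational numbers, (a n : ℚ) = (−1)^n · ∑_{c : Composition n} (ℓ c)! · (−2)^{ℓ c} / 2^{t c}, where the sum is over all compositions c of n, ℓ c is the number of parts of c, and t c is the number of parts of c equal to 1. -/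
def KTiling {l : ℕ} (k : Fin l → ℕ) (N : ℕ) (s : Fin l → ℕ) : Prop :=
  (∀ i, s i + k i ≤ N) ∧ ∀ i i', i ≠ i' → s i + k i ≤ s i' ∨ s i' + k i' ≤ s i

lemma ktiling_start {l : ℕ} {k : Fin l → ℕ} (hk : ∀ i, 0 < k i) {N : ℕ} (hN : ∑ i, k i = N)
    {s : Fin l → ℕ} (h : KTiling k N s) (i : Fin l) :
    s i = ∑ i' ∈ Finset.univ.filter (fun i' => s i' < s i), k i' := by
  have hdis : ∀ (A : Finset (Fin l)),
      (A.biUnion (fun i => Finset.Ico (s i) (s i + k i))).card = ∑ i ∈ A, k i := by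
    intro A
    rw [Finset.card_biUnion]
    · simp
    · intro x _ y _ hxy
      rw [Function.onFun, Finset.disjoint_left]
      intro a ha hb
      simp only [Finset.mem_Ico] at ha hb
      rcases h.2 x y hxy with h1 | h1 <;> omega
  have hcov : Finset.univ.biUnion (fun i => Finset.Ico (s i) (s i + k i)) = Finset.range N := by
    apply Finset.eq_of_subset_of_card_le
    · intro a ha
      simp only [Finset.mem_biUnion, Finset.mem_Ico, Finset.mem_univ, true_and] at ha
      obtain ⟨x, hx⟩ := ha
      have := h.1 x
      simp only [Finset.mem_range]; omega
    · rw [hdis, hN]; simp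
  rw [← hdis]
  conv_lhs => rw [← Finset.card_range (s i)]
  congr 1
  ext a
  simp only [Finset.mem_biUnion, Finset.mem_Ico, Finset.mem_filter, Finset.mem_univ, true_and,
    Finset.mem_range]
  constructor
  · intro ha
    have : a ∈ Finset.range N := by
      have := h.1 i
      simp only [Finset.mem_range]; omega
    rw [← hcov] at this
    simp only [Finset.mem_biUnion, Finset.mem_Ico, Finset.mem_univ, true_and] at this
    obtain ⟨x, hx⟩ := this
    exact ⟨x, by omega, hx⟩
  · rintro ⟨x, hx, hx2⟩
    have hne : x ≠ i := by rintro rfl; omega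
    rcases h.2 x i hne with h1 | h1
    · omega
    · have := hk i; omega

lemma ktiling_card {l : ℕ} {k : Fin l → ℕ} (hk : ∀ i, 0 < k i) {N : ℕ} (hN : ∑ i, k i = N) :
    Nat.card {s : Fin l → ℕ // KTiling k N s} = l.factorial := by
  have hperm : Nat.card (Equiv.Perm (Fin l)) = l.factorial := by
    simp [Fintype.card_perm]
  rw [← hperm]
  symm
  let F : Equiv.Perm (Fin l) → Fin l → ℕ := fun σ i =>
    ∑ i' ∈ Finset.univ.filter (fun i' => σ i' < σ i), k i'
  have hlt : ∀ σ i i', σ i < σ i' → F σ i + k i ≤ F σ i' := by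
    intro σ i i' hlt
    have : F σ i + k i = ∑ j ∈ insert i (Finset.univ.filter (fun i' => σ i' < σ i)), k j := by
      rw [Finset.sum_insert (by simp), add_comm]
    rw [this]
    apply Finset.sum_le_sum_of_subset
    intro a ha
    simp only [Finset.mem_insert, Finset.mem_filter, Finset.mem_univ, true_and] at ha ⊢
    rcases ha with rfl | ha
    · exact hlt
    · exact ha.trans hlt
  have hF : ∀ σ, KTiling k N (F σ) := by
    intro σ
    constructor
    · intro i
      have : F σ i + k i = ∑ j ∈ insert i (Finset.univ.filter (fun i' => σ i' < σ i)), k j := by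
        rw [Finset.sum_insert (by simp), add_comm]
      rw [this, ← hN]
      exact Finset.sum_le_sum_of_subset (Finset.subset_univ _)
    · intro i i' hne
      rcases lt_or_gt_of_ne (σ.injective.ne hne) with h | h
      · exact Or.inl (hlt σ _ _ h)
      · exact Or.inr (hlt σ _ _ h)
  have hiff : ∀ σ i i', F σ i < F σ i' ↔ σ i < σ i' := by
    intro σ i i'
    constructor
    · intro h
      by_contra hc
      rcases (not_lt.mp hc).lt_or_eq with h1 | h1
      · have := hlt σ _ _ h1; omega
      · have := σ.injective h1
        subst this; omega
    · intro h
      have := hlt σ _ _ h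
      have := hk i
      omega
  have hcard : ∀ (σ : Equiv.Perm (Fin l)) i,
      (Finset.univ.filter (fun i' => σ i' < σ i)).card = (σ i : ℕ) := by
    intro σ i
    have : Finset.univ.filter (fun i' => σ i' < σ i) = (Finset.Iio (σ i)).map σ.symm.toEmbedding := by
      ext a; simp
    rw [this]; simp
  refine Nat.card_eq_of_bijective (fun σ => (⟨F σ, hF σ⟩ : {s : Fin l → ℕ // KTiling k N s})) ⟨?_, ?_⟩
  · intro σ τ h
    have h : F σ = F τ := congrArg Subtype.val h
    ext i
    rw [← hcard σ, ← hcard τ]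
    congr 2
    ext i'
    rw [← hiff, ← hiff, h]
  · rintro ⟨s, hs⟩
    refine ⟨(Tuple.sort s)⁻¹, ?_⟩
    apply Subtype.ext
    funext i
    have hm := Tuple.monotone_sort s
    have hval : ∀ a, s (Tuple.sort s ((Tuple.sort s)⁻¹ a)) = s a := by intro a; simp
    have hsi : ∀ a b, s a = s b → a = b := by
      intro a b hab
      by_contra hne
      have := hk a
      have := hk b
      rcases hs.2 a b hne with h | h <;> omega
    refine Eq.trans ?_ (ktiling_start hk hN hs i).symm
    change F _ i = _
    simp only [F]
    congr 1
    ext i'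
    simp only [Finset.mem_filter, Finset.mem_univ, true_and]
    constructor
    · intro h
      have h2 := hm h.le
      simp only [Function.comp] at h2
      rw [hval, hval] at h2
      rcases h2.lt_or_eq with h3 | h3
      · exact h3
      · rw [hsi _ _ h3] at h; exact absurd h (lt_irrefl _)
    · intro h
      by_contra hc
      have h2 := hm (not_lt.mp hc)
      simp only [Function.comp] at h2
      rw [hval, hval] at h2
      omega

lemma kprog (k : ℕ) (g : ℕ → ℕ) (h1 : ∀ j, j + 1 < k → g (j+1) = g j + 1 ∨ g j = g (j+1) + 1)
    (h2 : ∀ j, j + 2 < k → g j ≠ g (j+2)) :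
    (∀ j, j < k → g j = g 0 + j) ∨ (1 < k ∧ ∀ j, j < k → g j + j = g 0) := by
  by_cases hk : 1 < k
  · rcases h1 0 (by omega) with h | h
    · left
      have key : ∀ j, j + 1 < k → g j = g 0 + j ∧ g (j+1) = g 0 + (j + 1) := by
        intro j
        induction j with
        | zero => intro _; simp at h ⊢; omega
        | succ j ih =>
          intro hj
          have a := ih (by omega)
          have b := h1 (j+1) hj
          have c := h2 j hj
          refine ⟨a.2, ?_⟩
          have : j + 1 + 1 = j + 2 := rfl
          rw [this] at *
          omega
      intro j hj
      rcases j with _ | j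
      · rfl
      · exact (key j hj).2
    · right
      refine ⟨hk, ?_⟩
      have key : ∀ j, j + 1 < k → g j + j = g 0 ∧ g (j+1) + (j + 1) = g 0 := by
        intro j
        induction j with
        | zero => intro _; simp at h ⊢; omega
        | succ j ih =>
          intro hj
          have a := ih (by omega)
          have b := h1 (j+1) hj
          have c := h2 j hj
          refine ⟨a.2, ?_⟩
          have : j + 1 + 1 = j + 2 := rfl
          rw [this] at *
          omega
      intro j hj
      rcases j with _ | j
      · rfl
      · exact (key j hj).2
  · left
    intro j hj
    have : j = 0 := by omega
    subst this; rfl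

def KValid {l : ℕ} (k : Fin l → ℕ) (N : ℕ) (f : (Σ i, Fin (k i)) → Fin N) : Prop :=
  Function.Injective f ∧ ∀ i (j : ℕ) (hj : j + 1 < k i),
    (f ⟨i, ⟨j+1, hj⟩⟩ : ℕ) = f ⟨i, ⟨j, by omega⟩⟩ + 1 ∨
    (f ⟨i, ⟨j, by omega⟩⟩ : ℕ) = f ⟨i, ⟨j+1, hj⟩⟩ + 1

lemma kvalid_card {l : ℕ} {k : Fin l → ℕ} (hk : ∀ i, 0 < k i) {N : ℕ} (hN : ∑ i, k i = N) :
    Nat.card {f : (Σ i, Fin (k i)) → Fin N // KValid k N f} =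
      l.factorial * ∏ i, (if k i = 1 then 1 else 2) := by
  have hO : Nat.card (∀ i, {b : Bool // k i = 1 → b = false}) =
      ∏ i, (if k i = 1 then 1 else 2) := by
    rw [Nat.card_pi]
    apply Finset.prod_congr rfl
    intro i _
    by_cases h : k i = 1 <;> simp [h]
  rw [← hO, ← ktiling_card hk hN, ← Nat.card_prod]
  symm
  let G : {s : Fin l → ℕ // KTiling k N s} × (∀ i, {b : Bool // k i = 1 → b = false}) →
      (Σ i, Fin (k i)) → ℕ := fun p x => p.1.1 x.1 +
        if (p.2 x.1).1 = true then k x.1 - 1 - x.2.1 else x.2.1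
  have hG : ∀ p x, p.1.1 x.1 ≤ G p x ∧ G p x < p.1.1 x.1 + k x.1 := by
    intro p x
    have := x.2.2
    simp only [G]
    split_ifs <;> omega
  have hG2 : ∀ p x, G p x < N := by
    intro p x
    have := hG p x
    have := p.1.2.1 x.1
    omega
  have hV : ∀ p, KValid k N (fun x => ⟨G p x, hG2 p x⟩) := by
    intro p
    constructor
    · rintro ⟨i, j⟩ ⟨i', j'⟩ h
      have h : G p ⟨i, j⟩ = G p ⟨i', j'⟩ := congrArg Fin.val h
      by_cases hne : i = i'
      · subst hne
        have : j = j' := by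
          ext
          have := j.2
          have := j'.2
          simp only [G] at h
          split_ifs at h <;> omega
        rw [this]
      · have a := hG p ⟨i, j⟩
        have b := hG p ⟨i', j'⟩
        simp only at a b
        rcases p.1.2.2 i i' hne with h' | h' <;> omega
    · intro i j hj
      simp only [G]
      split_ifs <;> omega
  refine Nat.card_eq_of_bijective
    (fun p => (⟨fun x => ⟨G p x, hG2 p x⟩, hV p⟩ : {f : (Σ i, Fin (k i)) → Fin N // KValid k N f}))
    ⟨?_, ?_⟩
  · intro p q hpq
    have h : ∀ x, G p x = G q x := fun x =>
      congrArg Fin.val (congrFun (congrArg Subtype.val hpq) x)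
    have key : ∀ i, p.1.1 i = q.1.1 i ∧ (p.2 i).1 = (q.2 i).1 := by
      intro i
      have a := h ⟨i, ⟨0, hk i⟩⟩
      have b := h ⟨i, ⟨k i - 1, by have := hk i; omega⟩⟩
      have c := (p.2 i).2
      have d := (q.2 i).2
      have := hk i
      simp only [G] at a b
      cases hp : (p.2 i).1 <;> cases hq : (q.2 i).1 <;> simp [hp, hq] at a b c d ⊢ <;> omega
    refine Prod.ext (Subtype.ext (funext fun i => (key i).1)) (funext fun i => Subtype.ext (key i).2)
  · rintro ⟨f, hf⟩
    have H : ∀ i, ∃ (s : ℕ) (b : {b : Bool // k i = 1 → b = false}), ∀ j : Fin (k i),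
        (f ⟨i, j⟩ : ℕ) = s + if b.1 = true then k i - 1 - j.1 else j.1 := by
      intro i
      let g : ℕ → ℕ := fun j => if hj : j < k i then f ⟨i, ⟨j, hj⟩⟩ else 0
      have hg : ∀ j : Fin (k i), g j = f ⟨i, j⟩ := by intro j; simp [g]
      have h1 : ∀ j, j + 1 < k i → g (j+1) = g j + 1 ∨ g j = g (j+1) + 1 := by
        intro j hj
        have a := hg ⟨j+1, hj⟩
        have b := hg ⟨j, by omega⟩
        simp only at a b
        rw [a, b]
        exact hf.2 i j hj
      have h2 : ∀ j, j + 2 < k i → g j ≠ g (j+2) := by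
        intro j hj he
        have a := hg ⟨j+2, hj⟩
        have b := hg ⟨j, by omega⟩
        simp only at a b
        rw [a, b] at he
        have := hf.1 (Fin.ext he)
        simp at this
      rcases kprog (k i) g h1 h2 with h | ⟨h0, h⟩
      · refine ⟨g 0, ⟨false, fun _ => rfl⟩, ?_⟩
        intro j
        rw [← hg, h j j.2]; simp
      · refine ⟨g (k i - 1), ⟨true, fun h => by omega⟩, ?_⟩
        intro j
        have a := h j j.2
        have b := h (k i - 1) (by omega)
        have := j.2
        rw [← hg]; simp; omega
    choose s b hs using H
    have hsurj : ∀ i v, s i ≤ v → v < s i + k i → ∃ j : Fin (k i), (f ⟨i, j⟩ : ℕ) = v := by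
      intro i v h1 h2
      by_cases hb : (b i).1 = true
      · refine ⟨⟨k i - 1 - (v - s i), by omega⟩, ?_⟩
        rw [hs, if_pos hb]; simp only; omega
      · refine ⟨⟨v - s i, by omega⟩, ?_⟩
        rw [hs, if_neg hb]; simp only; omega
    have hT : KTiling k N s := by
      constructor
      · intro i
        have := hk i
        obtain ⟨j, hj⟩ := hsurj i (s i + k i - 1) (by omega) (by omega)
        have := (f ⟨i, j⟩).2
        omega
      · intro i i' hne
        by_contra hc
        push Not at hc
        have := hk i
        have := hk i'
        obtain ⟨j, hj⟩ := hsurj i (max (s i) (s i')) (by omega) (by omega)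
        obtain ⟨j', hj'⟩ := hsurj i' (max (s i) (s i')) (by omega) (by omega)
        have := hf.1 (Fin.ext (hj.trans hj'.symm))
        simp at this
        exact hne this.1
    refine ⟨(⟨s, hT⟩, b), ?_⟩
    apply Subtype.ext
    funext x
    apply Fin.ext
    exact (hs x.1 x.2).symm

def KBad {n : ℕ} (π : Equiv.Perm (Fin n)) (i : Fin (n - 1)) : Prop :=
  (π ⟨i + 1, by omega⟩ : ℕ) = π ⟨i, by omega⟩ + 1 ∨
  (π ⟨i, by omega⟩ : ℕ) = π ⟨i + 1, by omega⟩ + 1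

lemma noGrowth_iff {n : ℕ} (π : Equiv.Perm (Fin n)) :
    NoGrowth π ↔ ∀ i, ¬ KBad π i := by
  constructor
  · intro h i hb
    refine h (⟨i, by omega⟩, π ⟨i + 1, by omega⟩) ⟨?_, (⟨i, by omega⟩, π ⟨i, by omega⟩), rfl,
      (⟨i + 1, by omega⟩, π ⟨i + 1, by omega⟩), rfl, ?_, ?_, ?_⟩
    · intro hc
      have := π.injective (show π ⟨i + 1, _⟩ = π ⟨i, _⟩ from hc)
      simp at this
    · intro hc
      simp at hc
    · left
      refine ⟨rfl, ?_⟩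
      unfold KBad at hb
      simp only
      omega
    · right
      exact ⟨rfl, Or.inl rfl⟩
  · intro h c hc
    have key : ∀ x y : Fin n, (x : ℕ) + 1 = y →
        ¬ ((π y : ℕ) = π x + 1 ∨ (π x : ℕ) = π y + 1) := by
      intro x y hxy hb
      refine h ⟨x, by omega⟩ ?_
      have : (⟨x + 1, by omega⟩ : Fin n) = y := Fin.ext hxy
      unfold KBad
      simp only [this]
      exact hb
    obtain ⟨_, ⟨d1, d2⟩, hd, ⟨e1, e2⟩, he, hne, h1, h2⟩ := hc
    obtain ⟨c1, c2⟩ := c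
    simp only [graphOf, Set.mem_setOf_eq] at hd he
    subst hd he
    have inj : ∀ a b : Fin n, (π a : ℕ) = π b → a = b := fun a b h => π.injective (Fin.ext h)
    have hne' : d1 ≠ e1 := by rintro rfl; exact hne rfl
    unfold Adj at h1 h2
    simp only at h1 h2
    rcases h1 with ⟨a, a'⟩ | ⟨a, a'⟩ <;> rcases h2 with ⟨b, b'⟩ | ⟨b, b'⟩
    · exact hne' (a.symm.trans b)
    · subst a b
      rcases b' with b' | b'
      · exact key _ _ b' (by omega)
      · exact key _ _ b' (by omega)
    · subst a b
      rcases a' with b' | b'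
      · exact key _ _ b' (by omega)
      · exact key _ _ b' (by omega)
    · exact hne' (π.injective (a.symm.trans b))

def kE (n : ℕ) : Composition n ≃ Finset (Fin (n - 1)) :=
  (compositionEquiv n).trans (compositionAsSetEquiv n)

lemma mem_kE {n : ℕ} (c : Composition n) (i : Fin (n - 1)) :
    i ∈ kE n c ↔ (⟨1 + (i : ℕ), by omega⟩ : Fin n.succ) ∈ c.boundaries := by
  simp only [kE, Equiv.trans_apply, compositionAsSetEquiv, compositionEquiv, Equiv.coe_fn_mk,
    Set.mem_toFinset]
  rfl

lemma mem_kE' {n : ℕ} (c : Composition n) (i : Fin (n - 1)) :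
    i ∈ kE n c ↔ ∃ m, c.sizeUpTo m = i + 1 := by
  rw [mem_kE]
  simp only [Composition.boundaries, Finset.mem_map, Finset.mem_univ, true_and]
  constructor
  · rintro ⟨m, hm⟩
    refine ⟨m, ?_⟩
    have := congrArg Fin.val hm
    simp [Composition.boundary] at this
    omega
  · rintro ⟨m, hm⟩
    by_cases h : m < c.length + 1
    · refine ⟨⟨m, h⟩, ?_⟩
      apply Fin.ext
      simp [Composition.boundary]
      omega
    · rw [c.sizeUpTo_ofLength_le m (by omega)] at hm
      omega

lemma card_kE {n : ℕ} (hn : 1 ≤ n) (c : Composition n) :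
    (kE n c).card + 1 = c.length := by
  have h := c.card_boundaries_eq_succ_length
  have hb : c.boundaries = insert 0 (insert (Fin.last n)
      ((kE n c).image (fun i : Fin (n - 1) => (⟨1 + (i : ℕ), by omega⟩ : Fin n.succ)))) := by
    ext a
    simp only [Finset.mem_insert, Finset.mem_image]
    constructor
    · intro ha
      by_cases h0 : a = 0
      · exact Or.inl h0
      by_cases h1 : a = Fin.last n
      · exact Or.inr (Or.inl h1)
      right; right
      have h0' : (a : ℕ) ≠ 0 := fun h => h0 (Fin.ext h)
      have h1' : (a : ℕ) ≠ n := fun h => h1 (Fin.ext h)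
      have h2 : (⟨1 + ((a : ℕ) - 1), by omega⟩ : Fin n.succ) = a := by
        apply Fin.ext; simp only; omega
      refine ⟨⟨a - 1, by omega⟩, ?_, h2⟩
      rw [mem_kE]
      simp only
      rw [h2]; exact ha
    · rintro (rfl | rfl | ⟨i, hi, rfl⟩)
      · exact c.toCompositionAsSet.zero_mem
      · exact c.toCompositionAsSet.getLast_mem
      · exact (mem_kE c i).mp hi
  rw [hb, Finset.card_insert_of_notMem, Finset.card_insert_of_notMem,
    Finset.card_image_of_injective] at h
  · omega
  · intro x y hxy
    have := congrArg Fin.val hxy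
    simp only at this
    apply Fin.ext; omega
  · simp only [Finset.mem_image, not_exists, not_and]
    intro x _ hx
    have := congrArg Fin.val hx
    simp at this
    omega
  · simp only [Finset.mem_image, Finset.mem_insert, not_or, not_exists, not_and]
    constructor
    · intro hx
      have := congrArg Fin.val hx
      simp at this
      omega
    intro x _ hx
    have := congrArg Fin.val hx
    simp at this

lemma kprod (L : List ℕ) :
    (L.map (fun k => if k = 1 then 1 else 2)).prod * 2 ^ (L.count 1) = 2 ^ L.length := by
  induction L with
  | nil => simp
  | cons a L ih =>
    by_cases h : a = 1
    · subst h
      simp only [List.map_cons, List.prod_cons, List.count_cons_self, List.length_cons, pow_succ,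
        ← ih, if_true]
      ring
    · simp only [List.map_cons, List.prod_cons, List.count_cons_of_ne h, List.length_cons, pow_succ,
        ← ih, if_neg h]
      ring

lemma kcomp_card {n : ℕ} (c : Composition n) :
    Nat.card {π : Equiv.Perm (Fin n) // ∀ i ∈ (kE n c)ᶜ, KBad π i} * 2 ^ (c.blocks.count 1) =
      c.length.factorial * 2 ^ c.length := by
  have h1 : Nat.card {π : Equiv.Perm (Fin n) // ∀ i ∈ (kE n c)ᶜ, KBad π i} =
      Nat.card {f : (Σ i, Fin (c.blocksFun i)) → Fin n // KValid c.blocksFun n f} := by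
    have hiff : ∀ π : Equiv.Perm (Fin n), (∀ i ∈ (kE n c)ᶜ, KBad π i) ↔
        KValid c.blocksFun n (π ∘ c.blocksFinEquiv) := by
      intro π
      constructor
      · intro h
        refine ⟨π.injective.comp c.blocksFinEquiv.injective, ?_⟩
        intro i j hj
        have hs := c.sizeUpTo_succ' i
        have hle := c.sizeUpTo_le (i + 1)
        have := h ⟨c.sizeUpTo i + j, by omega⟩ (by
          rw [Finset.mem_compl, mem_kE']
          rintro ⟨m, hm⟩
          simp only at hm
          rcases Nat.lt_or_ge i.1 m with h | h
          · have := c.monotone_sizeUpTo (show i.1 + 1 ≤ m from h)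
            omega
          · have := c.monotone_sizeUpTo h
            omega)
        exact this
      · rintro ⟨_, h⟩ a ha
        rw [Finset.mem_compl, mem_kE'] at ha
        have hx : (a : ℕ) < n := by omega
        set x : Fin n := ⟨a, hx⟩ with hxd
        have e1 := c.sizeUpTo_index_le x
        have e2 := c.lt_sizeUpTo_index_succ x
        have hs := c.sizeUpTo_succ' (c.index x)
        have e3 : c.sizeUpTo (c.index x + 1) ≠ a + 1 := fun hh => ha ⟨_, hh⟩
        simp only [Fin.val_succ] at e2
        have e4 : (x : ℕ) = a := rfl
        have := h (c.index x) (a - c.sizeUpTo (c.index x)) (by omega)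
        have q1 : c.blocksFinEquiv ⟨c.index x, ⟨a - c.sizeUpTo (c.index x), by omega⟩⟩ = x := by
          apply Fin.ext
          show c.sizeUpTo (c.index x) + (a - c.sizeUpTo (c.index x)) = (a : ℕ)
          omega
        have q2 : c.blocksFinEquiv ⟨c.index x, ⟨a - c.sizeUpTo (c.index x) + 1, by omega⟩⟩ =
            ⟨a + 1, by omega⟩ := by
          apply Fin.ext
          show c.sizeUpTo (c.index x) + (a - c.sizeUpTo (c.index x) + 1) = (a : ℕ) + 1
          omega
        simp only [Function.comp, q1, q2] at this
        exact this
    refine Nat.card_eq_of_bijective (fun π => ⟨π.1 ∘ c.blocksFinEquiv, (hiff π.1).mp π.2⟩) ⟨?_, ?_⟩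
    · intro π τ h
      have h := congrArg Subtype.val h
      apply Subtype.ext
      ext a
      have := congrFun h (c.blocksFinEquiv.symm a)
      simp at this
      rw [this]
    · rintro ⟨f, hf⟩
      have hinj : Function.Injective (f ∘ c.blocksFinEquiv.symm) :=
        hf.1.comp c.blocksFinEquiv.symm.injective
      let π : Equiv.Perm (Fin n) := Equiv.ofBijective _ (Finite.injective_iff_bijective.mp hinj)
      have hπ : π ∘ c.blocksFinEquiv = f := by
        funext x
        simp [π]
      exact ⟨⟨π, (hiff π).mpr (by rw [hπ]; exact hf)⟩, Subtype.ext hπ⟩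
  rw [h1, kvalid_card c.one_le_blocksFun c.sum_blocksFun, mul_assoc]
  congr 1
  have := kprod c.blocks
  refine Eq.trans ?_ this
  congr 1
  conv_rhs => rw [← c.ofFn_blocksFun, List.map_ofFn, List.prod_ofFn]
  rfl

theorem stmt_18 (n : ℕ) (hn : 1 ≤ n) :
    (numNoGrowth n : ℚ) = (-1 : ℚ) ^ n *
      ∑ c : Composition n,
        (Nat.factorial c.length : ℚ) * (-2 : ℚ) ^ c.length / 2 ^ (c.blocks.count 1) := by
  classical
  have h1 : (numNoGrowth n : ℚ) =
      ∑ π : Equiv.Perm (Fin n), ∏ i : Fin (n - 1), (1 - if KBad π i then (1 : ℚ) else 0) := by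
    have hp : ∀ π : Equiv.Perm (Fin n), ∏ i : Fin (n - 1), (1 - if KBad π i then (1 : ℚ) else 0)
        = if NoGrowth π then 1 else 0 := by
      intro π
      split_ifs with h
      · rw [noGrowth_iff] at h
        exact Finset.prod_eq_one fun i _ => by simp [h i]
      · rw [noGrowth_iff] at h
        push Not at h
        obtain ⟨i, hi⟩ := h
        exact Finset.prod_eq_zero (Finset.mem_univ i) (by simp [hi])
    simp_rw [hp]
    rw [numNoGrowth, Nat.card_eq_fintype_card, Fintype.card_subtype, Finset.sum_boole]
  have h2 : ∀ π : Equiv.Perm (Fin n),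
      ∏ i : Fin (n - 1), (1 - if KBad π i then (1 : ℚ) else 0) =
      ∑ S : Finset (Fin (n - 1)), (-1) ^ S.card * if (∀ i ∈ S, KBad π i) then (1 : ℚ) else 0 := by
    intro π
    simp only [sub_eq_add_neg]
    rw [Finset.prod_one_add, Finset.powerset_univ]
    refine Finset.sum_congr rfl fun S _ => ?_
    rw [Finset.prod_neg, Finset.prod_ite_zero]
    simp
  rw [h1]
  simp_rw [h2]
  rw [Finset.sum_comm, Finset.mul_sum,
    ← Equiv.sum_comp ((kE n).trans (Equiv.ofBijective _ compl_bijective))]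
  refine Finset.sum_congr rfl fun c _ => ?_
  rw [← Finset.mul_sum, Finset.sum_boole]
  have h3 := kcomp_card c
  rw [Nat.card_eq_fintype_card, Fintype.card_subtype] at h3
  simp only [Equiv.trans_apply, Equiv.ofBijective_apply]
  have h4 : (-1 : ℚ) ^ ((kE n c)ᶜ).card = (-1) ^ n * (-1) ^ c.length := by
    have := card_kE hn c
    have h5 : ((kE n c)ᶜ).card + c.length = n := by
      have h6 := Finset.card_add_card_compl (kE n c)
      rw [Fintype.card_fin] at h6
      omega
    have h8 : (-1 : ℚ) ^ n = (-1) ^ (((kE n c)ᶜ).card + c.length) := by rw [h5]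
    rw [h8, pow_add, mul_assoc, ← mul_pow]
    simp
  have h7 : (-2 : ℚ) ^ c.length = (-1) ^ c.length * 2 ^ c.length := by
    rw [← mul_pow]; norm_num
  rw [h4, h7, mul_assoc]
  congr 1
  rw [eq_div_iff (by positivity), mul_assoc]
  have h3' := congrArg (Nat.cast : ℕ → ℚ) h3
  push_cast at h3'
  rw [h3']
  ring
end
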